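/- arXiv:math/0106185 — 2 statements merged into one kernel-verified Lean document; each statement's English description precedes it below -/
import Mathlib

section
/- Let A be a finite-dimensional algebra over a field K which is a splitting field for A, and let P be an indecomposable projective right A-module. Then the endomorphism algebra End_A(P) has finite representation type if and only if End_A(P) is isomorphic as a K-algebra to K[x]/⟨x^m⟩ for some integer m ≥ 1. -/
/-- A finite-dimensional right `A`-module, where `A` is a `K`-algebra.
Right modules are modules over the opposite ring `Aᵐᵒᵖ`. -/
structure FDRightModule (K A : Type) [Field K] [Ring A] [Algebra K A] : Type 1 where
  carrier : Type
  [isAddCommGroup : AddCommGroup carrier]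
  [isModuleK : Module K carrier]
  [isModuleA : Module Aᵐᵒᵖ carrier]
  [isTower : IsScalarTower K Aᵐᵒᵖ carrier]
  [isFinDim : FiniteDimensional K carrier]

attribute [instance] FDRightModule.isAddCommGroup FDRightModule.isModuleK
  FDRightModule.isModuleA FDRightModule.isTower FDRightModule.isFinDim

/-- A module is indecomposable if it is nonzero and is not the (internal) direct
sum of two nonzero submodules. -/
def IsIndecomposableModule (R M : Type*) [Ring R] [AddCommGroup M] [Module R M] : Prop :=
  Nontrivial M ∧ ∀ N₁ N₂ : Submodule R M, IsCompl N₁ N₂ → N₁ = ⊥ ∨ N₂ = ⊥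

/-- A `K`-algebra `A` has finite representation type if there are only finitely many
isomorphism classes of indecomposable finite-dimensional right `A`-modules. -/
def HasFiniteRepresentationType (K A : Type) [Field K] [Ring A] [Algebra K A] : Prop :=
  Finite (Quot fun M N : {M : FDRightModule K A // IsIndecomposableModule Aᵐᵒᵖ M.carrier} =>
    Nonempty (M.1.carrier ≃ₗ[Aᵐᵒᵖ] N.1.carrier))
/-- `K` is a splitting field for the `K`-algebra `A` if every `A`-endomorphism of every
simple right `A`-module is multiplication by a scalar from `K`. -/
def IsSplittingFieldFor (K A : Type) [Field K] [Ring A] [Algebra K A] : Prop :=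
  ∀ (D : Type) [AddCommGroup D] [Module Aᵐᵒᵖ D], IsSimpleModule Aᵐᵒᵖ D →
    ∀ φ : D →ₗ[Aᵐᵒᵖ] D, ∃ c : K, ∀ x : D, φ x = algebraMap K Aᵐᵒᵖ c • x


section Projective

variable {B : Type*} [Ring B]

/-- A nonzero module over a semiprimary ring has a maximal submodule. -/
theorem IsSemiprimaryRing.exists_isCoatom [IsSemiprimaryRing B] (M : Type*) [AddCommGroup M]
    [Module B M] [Nontrivial M] : ∃ N : Submodule B M, IsCoatom N := by
  have key : Nontrivial M → ∃ N : Submodule B M, IsCoatom N := by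
    refine IsSemiprimaryRing.induction B B M
      (P := fun M _ _ _ ↦ Nontrivial M → ∃ N : Submodule B M, IsCoatom N) ?_ ?_
    · intro M _ _ _ _ _ _ _
      obtain h | ⟨N, hN, -⟩ := IsCoatomic.eq_top_or_exists_le_coatom (⊥ : Submodule B M)
      · exact absurd h bot_ne_top
      · exact ⟨N, hN⟩
    · intro M _ _ _ _ N hN hQ _
      by_cases h : N = ⊤
      · have e : N ≃ₗ[B] M := (LinearEquiv.ofEq N ⊤ h).trans Submodule.topEquiv
        obtain ⟨L, hL⟩ := hN e.toEquiv.nontrivial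
        exact ⟨Submodule.orderIsoMapComap e L, (OrderIso.isCoatom_iff _ _).2 hL⟩
      · obtain ⟨L, hL⟩ := hQ (Submodule.Quotient.nontrivial_iff.2 h)
        exact ⟨L.comap N.mkQ, (Submodule.isCoatom_comap_iff N.mkQ_surjective).2 hL⟩
  exact key inferInstance

/-- **Fitting's lemma**: an endomorphism of an indecomposable module of finite length is
nilpotent or bijective. -/
theorem IsIndecomposableModule.isNilpotent_or_bijective {M : Type*} [AddCommGroup M] [Module B M]
    [IsNoetherian B M] [IsArtinian B M] (hM : IsIndecomposableModule B M) (φ : Module.End B M) :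
    IsNilpotent φ ∨ Function.Bijective φ := by
  obtain ⟨n, hn, hn1⟩ := (φ.eventually_isCompl_ker_pow_range_pow.and
    (Filter.eventually_ge_atTop 1)).exists
  obtain h | h := hM.2 _ _ hn
  · have hinj : Function.Injective (φ ^ n) := LinearMap.ker_eq_bot.1 h
    have : Function.Injective φ := by
      rw [← Nat.sub_add_cancel hn1, pow_succ] at hinj
      exact Function.Injective.of_comp (f := (φ ^ (n - 1) : Module.End B M)) hinj
    exact .inr (IsArtinian.bijective_of_injective_endomorphism φ this)
  · exact .inl ⟨n, LinearMap.range_eq_bot.1 h⟩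

theorem LinearMap.isCompl_range_ker_of_bijective_comp {M N L : Type*} [AddCommGroup M]
    [AddCommGroup N] [AddCommGroup L] [Module B M] [Module B N] [Module B L] (k : M →ₗ[B] N)
    (h : N →ₗ[B] L) (hb : Function.Bijective (h ∘ₗ k)) :
    IsCompl (LinearMap.range k) (LinearMap.ker h) := by
  rw [isCompl_iff, Submodule.disjoint_def, codisjoint_iff, Submodule.eq_top_iff']
  constructor
  · rintro _ ⟨x, rfl⟩ hx
    rw [hb.1 (a₁ := x) (a₂ := 0) (by simpa using hx), map_zero]
  · intro y
    obtain ⟨x, hx⟩ := hb.2 (h y)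
    refine Submodule.mem_sup.2 ⟨k x, ⟨x, rfl⟩, y - k x, ?_, by abel⟩
    simpa [sub_eq_zero] using hx.symm

/-- If an indecomposable projective module `P` and some finite-dimensional projective module `Q`
have a common simple quotient, then `P` is finitely generated. -/
theorem IsIndecomposableModule.finite_of_projective {K : Type*} [Field K] [Algebra K B]
    {P S : Type*} [AddCommGroup P]
    [Module B P] [AddCommGroup S] [Module B S] [IsSimpleModule B S] [Module.Projective B P]
    (hP : IsIndecomposableModule B P) (g : P →ₗ[B] S) (hg : g ≠ 0)
    (Q : Type*) [AddCommGroup Q] [Module K Q] [Module B Q] [IsScalarTower K B Q]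
    [FiniteDimensional K Q] [Module.Projective B Q] (f : Q →ₗ[B] S) (hf : f ≠ 0) :
    Module.Finite B P := by
  induction hd : Module.finrank K Q using Nat.strong_induction_on generalizing Q with
  | _ d ih =>
  have : IsNoetherian B Q := isNoetherian_of_tower K inferInstance
  have : IsArtinian B Q := isArtinian_of_tower K inferInstance
  obtain ⟨h, hh⟩ := Module.projective_lifting_property f g (LinearMap.surjective_of_ne_zero hf)
  obtain ⟨k, hk⟩ := Module.projective_lifting_property g f (LinearMap.surjective_of_ne_zero hg)
  set φ : Module.End B Q := h ∘ₗ k with hφ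
  have hfφ : f ∘ₗ φ = f := by rw [hφ, ← LinearMap.comp_assoc, hh, hk]
  have hfn (n : ℕ) : f ∘ₗ (φ ^ n) = f := by
    induction n with
    | zero => rfl
    | succ n ihn => rw [pow_succ, Module.End.mul_eq_comp, ← LinearMap.comp_assoc, ihn, hfφ]
  obtain ⟨n, hn, hn1⟩ := (φ.eventually_isCompl_ker_pow_range_pow.and
    (Filter.eventually_ge_atTop 1)).exists
  by_cases htop : LinearMap.range (φ ^ n) = ⊤
  · have hφb : Function.Bijective φ := by
      apply IsNoetherian.bijective_of_surjective_endomorphism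
      have hs : Function.Surjective (φ ^ n) := LinearMap.range_eq_top.1 htop
      rw [← Nat.sub_add_cancel hn1, pow_succ'] at hs
      exact Function.Surjective.of_comp (g := (φ ^ (n - 1) : Module.End B Q)) hs
    have hc : IsCompl (LinearMap.range k) (LinearMap.ker h) :=
      LinearMap.isCompl_range_ker_of_bijective_comp k h hφb
    obtain h0 | h0 := hP.2 _ _ hc
    · rw [LinearMap.range_eq_bot] at h0
      exact absurd (by rw [← hk, h0, LinearMap.comp_zero]) hf
    · exact Module.Finite.of_injective h (LinearMap.ker_eq_bot.1 h0)
  · let Q' := LinearMap.range (φ ^ n)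
    have : Module.Projective B Q' := by
      refine Module.Projective.of_split Q'.subtype (Q'.projectionOnto _ hn.symm) ?_
      ext x
      simp [Submodule.projectionOnto_apply_left]
    have : FiniteDimensional K Q' :=
      inferInstanceAs (FiniteDimensional K (Q'.restrictScalars K))
    refine ih (Module.finrank K Q') ?_ Q' (f ∘ₗ Q'.subtype) ?_ rfl
    · rw [← hd]
      exact Submodule.finrank_lt (s := Q'.restrictScalars K) (by simpa using htop)
    · intro h0
      apply hf
      rw [← hfn n]
      ext x
      exact LinearMap.congr_fun h0 ⟨_, LinearMap.mem_range_self (φ ^ n) x⟩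

end Projective

section Augmentation

/-- The endomorphism algebra of an indecomposable projective module over a split
finite-dimensional algebra is finite-dimensional, and is an extension of `K` by a nil ideal. -/
theorem IsIndecomposableModule.exists_augmentation {K B : Type} [Field K] [Ring B] [Algebra K B]
    [FiniteDimensional K B]
    (hsplit : ∀ (D : Type) [AddCommGroup D] [Module B D], IsSimpleModule B D →
      ∀ φ : D →ₗ[B] D, ∃ c : K, ∀ x : D, φ x = algebraMap K B c • x)
    {P : Type} [AddCommGroup P] [Module K P] [Module B P] [IsScalarTower K B P]
    [Module.Projective B P] (hP : IsIndecomposableModule B P) :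
    FiniteDimensional K (Module.End B P) ∧
      ∃ ε : Module.End B P →ₐ[K] K, ∀ φ, ε φ = 0 → IsNilpotent φ := by
  have : IsArtinianRing B := isArtinian_of_tower K inferInstance
  have := hP.1
  obtain ⟨N, hN⟩ := IsSemiprimaryRing.exists_isCoatom (B := B) P
  have hS : IsSimpleModule B (P ⧸ N) := isSimpleModule_iff_isCoatom.2 hN
  set g := N.mkQ with hg
  have hgs : Function.Surjective g := N.mkQ_surjective
  have hg0 : g ≠ 0 := by
    rintro h
    exact hN.1 (by rw [← N.ker_mkQ, ← hg, h, LinearMap.ker_zero])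
  have hfinB : Module.Finite B P := by
    have := IsSimpleModule.nontrivial B (P ⧸ N)
    obtain ⟨s, hs⟩ := exists_ne (0 : P ⧸ N)
    refine hP.finite_of_projective (K := K) g hg0 B (LinearMap.toSpanSingleton B _ s) ?_
    intro h
    exact hs (by simpa using LinearMap.congr_fun h 1)
  have hfin : FiniteDimensional K P := Module.Finite.trans B P
  have : IsNoetherian B P := isNoetherian_of_tower K inferInstance
  have : IsArtinian B P := isArtinian_of_tower K inferInstance
  refine ⟨Module.Finite.of_injective (LinearMap.restrictScalarsₗ K B P P K)
    (LinearMap.restrictScalars_injective K), ?_⟩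
  have key (φ : Module.End B P) : ∃ c : K, g ∘ₗ φ = c • g := by
    by_cases h0 : g ∘ₗ φ = 0
    · exact ⟨0, by rw [h0, zero_smul]⟩
    have hle : LinearMap.ker g ≤ LinearMap.ker (g ∘ₗ φ) := by
      by_contra hle
      have hr : (g ∘ₗ φ) ∘ₗ (LinearMap.ker g).subtype ≠ 0 := by
        intro h
        exact hle fun x hx ↦ LinearMap.congr_fun h ⟨x, hx⟩
      obtain ⟨ψ, hψ⟩ := Module.projective_lifting_property _ (g ∘ₗ φ)
        (LinearMap.surjective_of_ne_zero hr)
      set θ : Module.End B P := (LinearMap.ker g).subtype ∘ₗ ψ with hθ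
      have h1 : (g ∘ₗ φ) ∘ₗ θ = g ∘ₗ φ := hψ
      have h2 : g ∘ₗ θ = 0 := by
        ext x
        exact (ψ x).2
      obtain ⟨n, hn⟩ | h := hP.isNilpotent_or_bijective θ
      · have h3 (n : ℕ) : (g ∘ₗ φ) ∘ₗ (θ ^ n) = g ∘ₗ φ := by
          induction n with
          | zero => rfl
          | succ n ihn => rw [pow_succ, Module.End.mul_eq_comp, ← LinearMap.comp_assoc, ihn, h1]
        exact h0 (by rw [← h3 n, hn, LinearMap.comp_zero])
      · apply hg0
        ext x
        obtain ⟨y, rfl⟩ := h.2 x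
        exact LinearMap.congr_fun h2 y
    rw [hg, Submodule.ker_mkQ] at hle
    obtain ⟨c, hc⟩ := hsplit (P ⧸ N) hS (N.liftQ _ hle)
    refine ⟨c, LinearMap.ext fun x ↦ ?_⟩
    exact (hc (g x)).trans (algebraMap_smul B c _)
  choose c hc using key
  obtain ⟨p, hp⟩ : ∃ p, g p ≠ 0 := by
    by_contra! h
    exact hg0 (LinearMap.ext h)
  have huniq (φ : Module.End B P) (a : K) (h : g ∘ₗ φ = a • g) : c φ = a := by
    have h1 := (hc φ).symm.trans h
    exact smul_left_injective K hp (LinearMap.congr_fun h1 p)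
  refine ⟨AlgHom.ofLinearMap
    { toFun := c
      map_add' := fun φ ψ ↦ huniq _ _ (by rw [LinearMap.comp_add, hc, hc, add_smul])
      map_smul' := fun a φ ↦ huniq _ _ (by
        rw [LinearMap.comp_smul, hc, smul_smul, RingHom.id_apply, smul_eq_mul]) }
    (huniq _ _ (by rw [one_smul]; rfl))
    (fun φ ψ ↦ huniq _ _ (by
      rw [Module.End.mul_eq_comp, ← LinearMap.comp_assoc, hc, LinearMap.smul_comp]
      change _ = (c φ * c ψ) • g
      rw [hc, smul_smul])), ?_⟩
  intro φ hφ
  replace hφ : c φ = 0 := hφ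
  refine (hP.isNilpotent_or_bijective φ).resolve_right fun hb ↦ hg0 ?_
  ext x
  obtain ⟨y, rfl⟩ := hb.2 x
  simpa [hφ] using LinearMap.congr_fun (hc φ) y

end Augmentation

section LocalAlgebra

variable {K E : Type*} [Field K] [Ring E] [Algebra K E]

theorem Submodule.isNilpotent_ker_of_forall_isNilpotent [FiniteDimensional K E] (ε : E →ₐ[K] K)
    (hε : ∀ a, ε a = 0 → IsNilpotent a) :
    ∃ n, LinearMap.ker ε.toLinearMap ^ n = (⊥ : Submodule K E) := by
  have hArt : IsArtinianRing E := isArtinian_of_tower K inferInstance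
  obtain ⟨n, hn⟩ := IsArtinianRing.isNilpotent_jacobson_bot (R := E)
  have hle (a : E) (ha : ε a = 0) : a ∈ Ideal.jacobson (⊥ : Ideal E) := by
    rw [Ideal.mem_jacobson_iff]
    intro b
    obtain ⟨z, hz⟩ := (hε (b * a) (by simp [ha])).isUnit_add_one.exists_left_inv
    refine ⟨z, ?_⟩
    rw [mul_add, mul_one, ← mul_assoc] at hz
    rw [hz, sub_self]
    exact Submodule.zero_mem _
  have hpow (k : ℕ) (a : E) (ha : a ∈ LinearMap.ker ε.toLinearMap ^ (k + 1)) :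
      a ∈ Ideal.jacobson (⊥ : Ideal E) ^ (k + 1) := by
    induction k generalizing a with
    | zero =>
      rw [zero_add, pow_one] at ha
      rw [zero_add, Submodule.pow_one]
      exact hle a ha
    | succ k ih =>
      rw [pow_succ] at ha
      rw [Submodule.pow_succ]
      refine Submodule.mul_induction_on ha (fun x hx y hy ↦ ?_) (fun x y hx hy ↦ add_mem hx hy)
      exact Ideal.mul_mem_mul (ih x hx) (hle y hy)
  refine ⟨n + 1, eq_bot_iff.2 fun a ha ↦ ?_⟩
  have := hpow n a ha
  rw [Submodule.pow_succ, hn, Ideal.zero_eq_bot, Ideal.bot_mul] at this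
  exact this

/-- A nil augmentation ideal that is spanned by a single element modulo its square consists of
polynomials in this element. -/
theorem Submodule.le_adjoin_of_le_span_sup_sq {I : Submodule K E} {x : E} (hx : x ∈ I)
    (hI : I ≤ Submodule.span K {x} ⊔ I ^ 2) (hI2 : I ^ 2 ≤ I) {n : ℕ}
    (hn : I ^ n = ⊥) : I ≤ Subalgebra.toSubmodule (Algebra.adjoin K {x}) := by
  have hxI : Submodule.span K {x} ≤ I := by simpa using hx
  have hpow (k : ℕ) : I ^ (k + 1) ≤ Submodule.span K {x ^ (k + 1)} ⊔ I ^ (k + 2) := by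
    induction k with
    | zero => simpa using hI
    | succ k ih =>
      have hxk : Submodule.span K {x ^ (k + 1)} ≤ I ^ (k + 1) := by
        simpa using Submodule.pow_mem_pow I hx (k + 1)
      calc I ^ (k + 2) = I ^ (k + 1) * I := pow_succ _ _
        _ ≤ (Submodule.span K {x ^ (k + 1)} ⊔ I ^ (k + 2)) * (Submodule.span K {x} ⊔ I ^ 2) :=
          mul_le_mul' ih hI
        _ ≤ Submodule.span K {x ^ (k + 2)} ⊔ I ^ (k + 3) := by
          have h1 : Submodule.span K {x ^ (k + 1)} * Submodule.span K {x} =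
              Submodule.span K {x ^ (k + 2)} := by
            rw [Submodule.span_mul_span, Set.singleton_mul_singleton, ← pow_succ]
          have h2 : Submodule.span K {x ^ (k + 1)} * I ^ 2 ≤ I ^ (k + 3) :=
            (mul_le_mul' hxk le_rfl).trans_eq (pow_add _ _ _).symm
          have h3 : I ^ (k + 2) * (Submodule.span K {x} ⊔ I ^ 2) ≤ I ^ (k + 3) := by
            refine (mul_le_mul' le_rfl (sup_le hxI ?_)).trans_eq (pow_succ _ _).symm
            exact hI2
          rw [Submodule.sup_mul, Submodule.mul_sup, h1]
          exact sup_le (sup_le_sup le_rfl h2) (h3.trans le_sup_right)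
  have hall (k : ℕ) : I ≤ Subalgebra.toSubmodule (Algebra.adjoin K {x}) ⊔ I ^ (k + 1) := by
    induction k with
    | zero => simp
    | succ k ih =>
      refine ih.trans (sup_le le_sup_left ((hpow k).trans (sup_le_sup ?_ le_rfl)))
      rw [Submodule.span_singleton_le_iff_mem]
      exact pow_mem (Algebra.self_mem_adjoin_singleton K x) _
  refine (hall n).trans ?_
  rw [pow_succ, hn, Submodule.bot_mul, sup_bot_eq]

open Polynomial in
theorem nonempty_algEquiv_quotient_X_pow [Nontrivial E] {x : E} (hx : IsNilpotent x)
    (htop : Algebra.adjoin K {x} = ⊤) :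
    ∃ m : ℕ, 1 ≤ m ∧ Nonempty (E ≃ₐ[K] K[X] ⧸ Ideal.span {(X : K[X]) ^ m}) := by
  obtain ⟨n, hn⟩ := hx
  have hsurj : Function.Surjective (aeval (R := K) x) := by
    rw [← AlgHom.range_eq_top, ← Algebra.adjoin_singleton_eq_range_aeval, htop]
  obtain ⟨p, hp⟩ := (IsPrincipalIdealRing.principal (RingHom.ker (aeval (R := K) x))).principal
  rw [Ideal.submodule_span_eq] at hp
  have hdvd : p ∣ X ^ n := by
    rw [← Ideal.mem_span_singleton, ← hp, RingHom.mem_ker]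
    simpa using hn
  obtain ⟨m, -, hm⟩ := (dvd_prime_pow prime_X n).1 hdvd
  have hker : RingHom.ker (aeval (R := K) x) = Ideal.span {(X : K[X]) ^ m} := by
    rw [hp, Ideal.span_singleton_eq_span_singleton.2 hm]
  refine ⟨m, Nat.one_le_iff_ne_zero.2 ?_, ⟨((Ideal.quotientEquivAlgOfEq K hker).symm.trans
    (Ideal.quotientKerAlgEquivOfSurjective hsurj)).symm⟩⟩
  rintro rfl
  have h1 : (1 : K[X]) ∈ RingHom.ker (aeval (R := K) x) := by rw [hker]; simp
  rw [RingHom.mem_ker, map_one] at h1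
  exact one_ne_zero h1

/-- A split local finite-dimensional algebra is either uniserial, or has two independent point
derivations at its augmentation. -/
theorem exists_adjoin_eq_top_or_exists_derivations [FiniteDimensional K E]
    (ε : E →ₐ[K] K) (hε : ∀ a, ε a = 0 → IsNilpotent a) :
    (∃ x : E, IsNilpotent x ∧ Algebra.adjoin K {x} = ⊤) ∨
    ∃ (α β : E →ₗ[K] K) (x y : E),
      (∀ a b, α (a * b) = ε a * α b + ε b * α a) ∧ (∀ a b, β (a * b) = ε a * β b + ε b * β a) ∧
      α x = 1 ∧ α y = 0 ∧ β x = 0 ∧ β y = 1 ∧ ε x = 0 ∧ ε y = 0 := by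
  set I : Submodule K E := LinearMap.ker ε.toLinearMap with hI
  set Q : Submodule K E := I ^ 2 ⊔ Submodule.span K {1} with hQ
  have hIsq : I ^ 2 ≤ I := by
    rw [pow_two, Submodule.mul_le]
    intro a ha b hb
    have ha' : ε a = 0 := ha
    simp [hI, ha']
  have hsub (a : E) : a - algebraMap K E (ε a) ∈ I := by simp [hI]
  have hone (c : K) : algebraMap K E c ∈ Q :=
    (le_sup_right : _ ≤ Q)
      (Submodule.mem_span_singleton.2 ⟨c, (Algebra.algebraMap_eq_smul_one c).symm⟩)
  by_cases hd : Module.finrank K (E ⧸ Q) ≤ 1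
  · left
    obtain ⟨v, hv⟩ := finrank_le_one_iff.1 hd
    obtain ⟨x₀, rfl⟩ := Q.mkQ_surjective v
    set x := x₀ - algebraMap K E (ε x₀) with hx
    have hxI : x ∈ I := hsub x₀
    have hle : I ≤ Submodule.span K {x} ⊔ I ^ 2 := by
      intro a ha
      obtain ⟨c, hc⟩ := hv (Q.mkQ a)
      have h1 : a - c • x ∈ Q := by
        rw [← map_smul, ← sub_eq_zero, ← map_sub] at hc
        have h2 : c • x₀ - a ∈ Q := (Submodule.Quotient.mk_eq_zero Q).1 hc
        have : a - c • x = c • algebraMap K E (ε x₀) - (c • x₀ - a) := by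
          rw [hx, smul_sub]; abel
        rw [this]
        exact Q.sub_mem (Q.smul_mem _ (hone _)) h2
      obtain ⟨q, hq, z, hz, hqz⟩ := Submodule.mem_sup.1 h1
      obtain ⟨d, rfl⟩ := Submodule.mem_span_singleton.1 hz
      have h3 : ε (a - c • x) = 0 := I.sub_mem ha (I.smul_mem c hxI)
      have h4 : ε q = 0 := hIsq hq
      have h5 : d = 0 := by
        rw [← hqz] at h3
        simpa [h4] using h3
      rw [h5, zero_smul, add_zero] at hqz
      refine Submodule.mem_sup.2 ⟨c • x, Submodule.mem_span_singleton.2 ⟨c, rfl⟩, q, hq, ?_⟩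
      rw [hqz]; abel
    obtain ⟨n, hn⟩ := Submodule.isNilpotent_ker_of_forall_isNilpotent ε hε
    have hadj := Submodule.le_adjoin_of_le_span_sup_sq hxI hle hIsq hn
    refine ⟨x, hε x hxI, Algebra.eq_top_iff.2 fun a ↦ ?_⟩
    rw [← sub_add_cancel a (algebraMap K E (ε a))]
    exact add_mem (hadj (hsub a)) (Subalgebra.algebraMap_mem _ _)
  · right
    push Not at hd
    let b := Module.finBasis K (E ⧸ Q)
    let i : Fin (Module.finrank K (E ⧸ Q)) := ⟨0, by omega⟩
    let j : Fin (Module.finrank K (E ⧸ Q)) := ⟨1, hd⟩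
    have hij : i ≠ j := by simp [i, j]
    obtain ⟨x, hx⟩ := Q.mkQ_surjective (b i)
    obtain ⟨y, hy⟩ := Q.mkQ_surjective (b j)
    have hone' (c : K) : Q.mkQ (algebraMap K E c) = 0 :=
      (Submodule.Quotient.mk_eq_zero Q).2 (hone c)
    have hmk (a : E) : Q.mkQ (a - algebraMap K E (ε a)) = Q.mkQ a := by
      rw [map_sub, hone' _, sub_zero]
    have hder (f : (E ⧸ Q) →ₗ[K] K) (a b : E) :
        f (Q.mkQ (a * b)) = ε a * f (Q.mkQ b) + ε b * f (Q.mkQ a) := by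
      have h1 : Q.mkQ ((a - algebraMap K E (ε a)) * (b - algebraMap K E (ε b))) = 0 := by
        refine (Submodule.Quotient.mk_eq_zero Q).2 ((le_sup_left : _ ≤ Q) ?_)
        rw [pow_two]
        exact Submodule.mul_mem_mul (hsub a) (hsub b)
      have h2 : a * b = (a - algebraMap K E (ε a)) * (b - algebraMap K E (ε b)) + ε a • b +
          ε b • a - algebraMap K E (ε a * ε b) := by
        rw [map_mul, Algebra.smul_def, Algebra.smul_def, Algebra.commutes (ε b) a]
        noncomm_ring
      rw [h2, map_sub, hone' _, map_add, map_add, h1]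
      simp
    refine ⟨b.coord i ∘ₗ Q.mkQ, b.coord j ∘ₗ Q.mkQ, x - algebraMap K E (ε x),
      y - algebraMap K E (ε y), hder (b.coord i), hder (b.coord j), ?_, ?_, ?_, ?_,
      hsub x, hsub y⟩ <;>
    simp only [LinearMap.comp_apply, hmk, hx, hy, Module.Basis.coord_apply,
      Module.Basis.repr_self, Finsupp.single_eq_same, Finsupp.single_apply, hij, hij.symm,
      if_false]

end LocalAlgebra

section InfiniteType

/-- A linear idempotent of the dual numbers over `C = K[T]` commuting with `ε` and `T ε` is
trivial as soon as `C` has only trivial idempotents. -/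
theorem DualNumber.eq_zero_or_eq_id_of_isIdempotent {K C : Type*} [Field K] [CommRing C]
    [Algebra K C] {T : C} (hT : Algebra.adjoin K {T} = ⊤)
    (hC : ∀ c : C, c * c = c → c = 0 ∨ c = 1) (π : DualNumber C →ₗ[K] DualNumber C)
    (hπ : ∀ z, π (π z) = π z)
    (h₁ : ∀ z, π (TrivSqZeroExt.inr 1 * z) = TrivSqZeroExt.inr 1 * π z)
    (h₂ : ∀ z, π (TrivSqZeroExt.inr T * z) = TrivSqZeroExt.inr T * π z) :
    π = 0 ∨ π = LinearMap.id := by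
  let p : C →ₗ[K] C :=
    { toFun := fun c ↦ (π (TrivSqZeroExt.inl c)).fst
      map_add' := by simp
      map_smul' := by simp }
  have hmul (d : C) (z : DualNumber C) :
      (TrivSqZeroExt.inr d : DualNumber C) * z = TrivSqZeroExt.inr (d * z.fst) := by
    ext <;> simp
  have hinr (c : C) : π (TrivSqZeroExt.inr c) = TrivSqZeroExt.inr (p c) := by
    have := h₁ (TrivSqZeroExt.inl c)
    rwa [hmul, hmul, one_mul, one_mul, TrivSqZeroExt.fst_inl] at this
  have hpT (c : C) : p (T * c) = T * p c := by
    have := h₂ (TrivSqZeroExt.inl c)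
    rw [hmul, hmul, TrivSqZeroExt.fst_inl, hinr] at this
    exact TrivSqZeroExt.inr_injective this
  have hinl (c : C) : π (TrivSqZeroExt.inl c) =
      TrivSqZeroExt.inl (p c) + TrivSqZeroExt.inr (π (TrivSqZeroExt.inl c)).snd :=
    (TrivSqZeroExt.inl_fst_add_inr_snd_eq _).symm
  have hpp (c : C) : p (p c) = p c := by
    have := congrArg TrivSqZeroExt.fst (hπ (TrivSqZeroExt.inl c))
    rw [hinl, map_add, hinr, TrivSqZeroExt.fst_add, TrivSqZeroExt.fst_inr, add_zero,
      TrivSqZeroExt.fst_add, TrivSqZeroExt.fst_inr, add_zero, TrivSqZeroExt.fst_inl] at this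
    exact this
  have hp (c : C) : ∀ d, p (c * d) = c * p d := by
    have hc : c ∈ Algebra.adjoin K {T} := hT ▸ Algebra.mem_top
    induction hc using Algebra.adjoin_induction with
    | mem x hx =>
      rw [Set.mem_singleton_iff] at hx
      rw [hx]
      exact hpT
    | algebraMap r => intro d; rw [← Algebra.smul_def, map_smul, Algebra.smul_def]
    | add x y _ _ hx hy => intro d; rw [add_mul, map_add, hx, hy, add_mul]
    | mul x y _ _ hx hy => intro d; rw [mul_assoc, hx, hy, mul_assoc]
  have hp1 (c : C) : p c = c * p 1 := by rw [← hp, mul_one]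
  have hext (g : DualNumber C →ₗ[K] DualNumber C)
      (hl : ∀ c, π (TrivSqZeroExt.inl c) = g (TrivSqZeroExt.inl c))
      (hr : ∀ c, π (TrivSqZeroExt.inr c) = g (TrivSqZeroExt.inr c)) : π = g := by
    refine LinearMap.ext fun z ↦ ?_
    rw [← TrivSqZeroExt.inl_fst_add_inr_snd_eq z, map_add, map_add, hl, hr]
  obtain h | h := hC (p 1) (by rw [← hp1, hpp])
  · have hp0 (c : C) : p c = 0 := by rw [hp1, h, mul_zero]
    refine .inl (hext _ (fun c ↦ ?_) fun c ↦ ?_)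
    · rw [← hπ, hinl, map_add, hinr, hp0, hp0]
      simp
    · rw [hinr, hp0]
      simp
  · have hpid (c : C) : p c = c := by rw [hp1, h, mul_one]
    refine .inr (hext _ (fun c ↦ ?_) fun c ↦ ?_)
    · obtain ⟨q, hq⟩ : ∃ q, π (TrivSqZeroExt.inl c) =
          TrivSqZeroExt.inl c + TrivSqZeroExt.inr q := ⟨_, (hinl c).trans (by rw [hpid])⟩
      have h3 := hπ (TrivSqZeroExt.inl c)
      rw [hq, map_add, hinr, hpid, hq] at h3
      rw [hq, add_eq_left.1 h3, add_zero]
      rfl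
    · rw [hinr, hpid]
      simp

/-- A commutative finite-dimensional algebra `D` is a right module over any algebra mapping
to it. -/
noncomputable def FDRightModule.ofAlgHom {K E D : Type} [Field K] [Ring E] [Algebra K E]
    [CommRing D] [Algebra K D] [FiniteDimensional K D] (ρ : E →ₐ[K] D) : FDRightModule K E :=
  letI : Module Eᵐᵒᵖ D := Module.compHom D (ρ.fromOpposite fun _ _ ↦ Commute.all _ _).toRingHom
  { carrier := D
    isTower := ⟨fun k r x ↦ by
      change ρ (k • r).unop * x = k • (ρ r.unop * x)
      rw [MulOpposite.unop_smul, map_smul, smul_mul_assoc]⟩ }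

/-- The algebra homomorphism to the dual numbers determined by two point derivations. -/
noncomputable def DualNumber.ofDerivations {K E C : Type*} [Field K] [Ring E] [Algebra K E]
    [CommRing C] [Algebra K C] (T : C) (ε : E →ₐ[K] K) (α β : E →ₗ[K] K)
    (hα : ∀ a b, α (a * b) = ε a * α b + ε b * α a)
    (hβ : ∀ a b, β (a * b) = ε a * β b + ε b * β a) : E →ₐ[K] DualNumber C :=
  AlgHom.ofLinearMap
    { toFun := fun a ↦ TrivSqZeroExt.inl (algebraMap K C (ε a)) +
        TrivSqZeroExt.inr (α a • (1 : C) + β a • T)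
      map_add' := fun a b ↦ by ext <;> simp [add_smul]; abel
      map_smul' := fun c a ↦ by ext <;> simp [mul_smul, Algebra.algebraMap_eq_smul_one] }
    (by
      have h1 : α 1 = 0 := by simpa using hα 1 1
      have h2 : β 1 = 0 := by simpa using hβ 1 1
      ext <;> simp [h1, h2])
    (fun a b ↦ by
      ext
      · simp
      · simp only [LinearMap.coe_mk, AddHom.coe_mk, TrivSqZeroExt.snd_add, TrivSqZeroExt.snd_inl,
          TrivSqZeroExt.snd_inr, TrivSqZeroExt.snd_mul, TrivSqZeroExt.fst_add,
          TrivSqZeroExt.fst_inl, TrivSqZeroExt.fst_inr, zero_add, add_zero, op_smul_eq_smul,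
          smul_eq_mul, hα, hβ, Algebra.smul_def (A := C), map_add, map_mul]
        ring)

theorem FDRightModule.isIndecomposable_ofAlgHom {K E C : Type} [Field K] [Ring E] [Algebra K E]
    [CommRing C] [Algebra K C] [Nontrivial C] {T : C}
    (hT : Algebra.adjoin K {T} = ⊤) (hC : ∀ c : C, c * c = c → c = 0 ∨ c = 1)
    [FiniteDimensional K (DualNumber C)]
    (ρ : E →ₐ[K] DualNumber C) {x y : E} (hx : ρ x = TrivSqZeroExt.inr 1)
    (hy : ρ y = TrivSqZeroExt.inr T) :
    IsIndecomposableModule Eᵐᵒᵖ (FDRightModule.ofAlgHom ρ).carrier := by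
  refine ⟨inferInstanceAs (Nontrivial (DualNumber C)), fun N₁ N₂ hN ↦ ?_⟩
  let f := N₁.projection N₂ hN
  let π : DualNumber C →ₗ[K] DualNumber C := f.restrictScalars K
  have key : π = 0 ∨ π = LinearMap.id := by
    refine DualNumber.eq_zero_or_eq_id_of_isIdempotent hT hC π (fun z ↦ ?_) (fun z ↦ ?_) fun z ↦ ?_
    · exact Submodule.projection_apply_of_mem_left hN (Submodule.projection_apply_mem hN z)
    · rw [← hx]
      exact f.map_smul (MulOpposite.op x) z
    · rw [← hy]
      exact f.map_smul (MulOpposite.op y) z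
  refine key.imp (fun h ↦ ?_) (fun h ↦ ?_)
  · refine eq_bot_iff.2 fun z hz ↦ ?_
    rw [← Submodule.projection_apply_of_mem_left hN hz]
    exact LinearMap.congr_fun h z
  · refine eq_bot_iff.2 fun z hz ↦ ?_
    have h1 : f z = 0 := Submodule.projection_apply_of_mem_right hN hz
    exact (LinearMap.congr_fun h z).symm.trans h1

/-- The dimension of an isomorphism class of indecomposable right modules. -/
noncomputable def indecomposableFinrank (K A : Type) [Field K] [Ring A] [Algebra K A] :
    (Quot fun M N : {M : FDRightModule K A // IsIndecomposableModule Aᵐᵒᵖ M.carrier} =>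
      Nonempty (M.1.carrier ≃ₗ[Aᵐᵒᵖ] N.1.carrier)) → ℕ :=
  Quot.lift (fun M ↦ Module.finrank K M.1.carrier)
    fun _ _ ⟨e⟩ ↦ (e.restrictScalars K).finrank_eq

open Polynomial in
theorem Polynomial.adjoin_quotient_mk_X {K : Type*} [Field K] (I : Ideal K[X]) :
    Algebra.adjoin K {Ideal.Quotient.mk I X} = ⊤ := by
  have h := congrArg (Subalgebra.map (Ideal.Quotient.mkₐ K I)) (Polynomial.adjoin_X (R := K))
  rw [AlgHom.map_adjoin, Set.image_singleton, Algebra.map_top,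
    (AlgHom.range_eq_top _).2 (Ideal.Quotient.mkₐ_surjective K _)] at h
  exact h

open Polynomial in
theorem Polynomial.eq_zero_or_eq_one_of_quotient_X_pow {K : Type*} [Field K] {n : ℕ}
    (c : K[X] ⧸ Ideal.span {(X : K[X]) ^ n}) (hc : c * c = c) : c = 0 ∨ c = 1 := by
  obtain ⟨f, rfl⟩ := Ideal.Quotient.mk_surjective c
  have h1 : X ^ n ∣ f * (f - 1) := by
    rw [← Ideal.mem_span_singleton, ← Ideal.Quotient.eq_zero_iff_mem, mul_sub, mul_one,
      map_sub, map_mul, hc, sub_self]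
  by_cases hf : (X : K[X]) ∣ f
  · left
    rw [Ideal.Quotient.eq_zero_iff_mem, Ideal.mem_span_singleton]
    refine prime_X.pow_dvd_of_dvd_mul_right _ (fun h ↦ ?_) h1
    exact prime_X.not_dvd_one (by simpa using dvd_sub hf h)
  · right
    rw [← sub_eq_zero, ← map_one (Ideal.Quotient.mk _), ← map_sub,
      Ideal.Quotient.eq_zero_iff_mem, Ideal.mem_span_singleton]
    exact prime_X.pow_dvd_of_dvd_mul_left _ hf h1

theorem FDRightModule.exists_isIndecomposable_of_derivations {K E C : Type} [Field K] [Ring E]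
    [Algebra K E] [CommRing C] [Algebra K C] [FiniteDimensional K C] [Nontrivial C] {T : C}
    (hT : Algebra.adjoin K {T} = ⊤) (hC : ∀ c : C, c * c = c → c = 0 ∨ c = 1)
    (ε : E →ₐ[K] K) (α β : E →ₗ[K] K) {x y : E}
    (hα : ∀ a b, α (a * b) = ε a * α b + ε b * α a)
    (hβ : ∀ a b, β (a * b) = ε a * β b + ε b * β a)
    (hαx : α x = 1) (hαy : α y = 0) (hβx : β x = 0) (hβy : β y = 1) (hx : ε x = 0)
    (hy : ε y = 0) : ∃ M : FDRightModule K E, IsIndecomposableModule Eᵐᵒᵖ M.carrier ∧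
      Module.finrank K M.carrier = 2 * Module.finrank K C := by
  have : FiniteDimensional K (DualNumber C) := inferInstanceAs (FiniteDimensional K (C × C))
  refine ⟨FDRightModule.ofAlgHom (DualNumber.ofDerivations T ε α β hα hβ),
    FDRightModule.isIndecomposable_ofAlgHom hT hC _ (x := x) (y := y) ?_ ?_, ?_⟩
  · simp [DualNumber.ofDerivations, hαx, hβx, hx]
  · simp [DualNumber.ofDerivations, hαy, hβy, hy]
  · change Module.finrank K (C × C) = _
    rw [Module.finrank_prod, two_mul]

open Polynomial in
theorem not_hasFiniteRepresentationType_of_derivations {K E : Type} [Field K] [Ring E]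
    [Algebra K E] (ε : E →ₐ[K] K) (α β : E →ₗ[K] K) {x y : E}
    (hα : ∀ a b, α (a * b) = ε a * α b + ε b * α a)
    (hβ : ∀ a b, β (a * b) = ε a * β b + ε b * β a)
    (hαx : α x = 1) (hαy : α y = 0) (hβx : β x = 0) (hβy : β y = 1) (hx : ε x = 0)
    (hy : ε y = 0) : ¬ HasFiniteRepresentationType K E := by
  intro hfin
  have main (n : ℕ) : ∃ M : FDRightModule K E, IsIndecomposableModule Eᵐᵒᵖ M.carrier ∧
      Module.finrank K M.carrier = 2 * (n + 1) := by
    have hdim : Module.finrank K (K[X] ⧸ Ideal.span {(X : K[X]) ^ (n + 1)}) = n + 1 :=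
      finrank_quotient_span_eq_natDegree.trans (natDegree_X_pow _)
    have : FiniteDimensional K (K[X] ⧸ Ideal.span {(X : K[X]) ^ (n + 1)}) :=
      Module.finite_of_finrank_pos (by omega)
    have : Nontrivial (K[X] ⧸ Ideal.span {(X : K[X]) ^ (n + 1)}) :=
      Module.nontrivial_of_finrank_pos (R := K) (by omega)
    have h := FDRightModule.exists_isIndecomposable_of_derivations
      (Polynomial.adjoin_quotient_mk_X (Ideal.span {(X : K[X]) ^ (n + 1)}))
      Polynomial.eq_zero_or_eq_one_of_quotient_X_pow ε α β hα hβ hαx hαy hβx hβy hx hy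
    rwa [hdim] at h
  choose M hM hMd using main
  have hinj : Function.Injective fun n ↦ (Quot.mk _ ⟨M n, hM n⟩ :
      Quot fun M N : {M : FDRightModule K E // IsIndecomposableModule Eᵐᵒᵖ M.carrier} =>
        Nonempty (M.1.carrier ≃ₗ[Eᵐᵒᵖ] N.1.carrier)) := by
    intro n k h
    have h1 : Module.finrank K (M n).carrier = Module.finrank K (M k).carrier :=
      congrArg (indecomposableFinrank K E) h
    rw [hMd, hMd] at h1
    omega
  have : Finite (Quot fun M N : {M : FDRightModule K E // IsIndecomposableModule Eᵐᵒᵖ M.carrier} =>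
      Nonempty (M.1.carrier ≃ₗ[Eᵐᵒᵖ] N.1.carrier)) := hfin
  exact not_injective_infinite_finite _ hinj

end InfiniteType

section FiniteType

theorem IsIndecomposableModule.of_bijective {R S M N : Type*} [Ring R] [Ring S] {σ : R →+* S}
    [RingHomSurjective σ] [AddCommGroup M] [Module R M] [AddCommGroup N] [Module S N]
    (hN : IsIndecomposableModule S N) (f : M →ₛₗ[σ] N) (hf : Function.Bijective f) :
    IsIndecomposableModule R M := by
  refine ⟨have := hN.1; hf.2.nontrivial, fun N₁ N₂ h ↦ ?_⟩
  let e := Submodule.orderIsoMapComapOfBijective f hf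
  simpa using hN.2 _ _ (e.isCompl h)

/-- If a direct sum is indecomposable, then it is isomorphic to one of its summands. -/
theorem IsIndecomposableModule.exists_bijective_component {R ι : Type*} [Ring R] {N : ι → Type*}
    [∀ i, AddCommGroup (N i)] [∀ i, Module R (N i)]
    (hN : IsIndecomposableModule R (DirectSum ι N)) :
    ∃ i, Function.Bijective (DirectSum.component R ι N i) := by
  classical
  obtain ⟨i, hi⟩ : ∃ i, Nontrivial (N i) := by
    by_contra! h
    have := hN.1
    exact not_subsingleton (DirectSum ι N) inferInstance
  have hpi := DirectSum.component_comp_lof_same R (M := N) i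
  have hb : Function.Bijective (DirectSum.component R ι N i ∘ₗ DirectSum.lof R ι N i) := by
    rw [hpi]
    exact Function.bijective_id
  have hc := LinearMap.isCompl_range_ker_of_bijective_comp _ _ hb
  refine ⟨i, LinearMap.ker_eq_bot.1 ((hN.2 _ _ hc).resolve_left fun h ↦ ?_),
    Function.Surjective.of_comp (g := DirectSum.lof R ι N i) hb.2⟩
  rw [LinearMap.range_eq_bot] at h
  obtain ⟨z, hz⟩ := exists_ne (0 : N i)
  apply hz
  rw [← LinearMap.id_apply (R := R) z, ← hpi, h, LinearMap.comp_zero, LinearMap.zero_apply]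

open Polynomial in
/-- An indecomposable finite-dimensional `K[X]`-module on which `X` is nilpotent is determined by
its dimension. -/
theorem IsIndecomposableModule.nonempty_equiv_quotient_X_pow {K M : Type} [Field K]
    [AddCommGroup M] [Module K M] [Module K[X] M] [IsScalarTower K K[X] M] [FiniteDimensional K M]
    (hM : IsIndecomposableModule K[X] M) {m : ℕ} (hm : ∀ z : M, (X : K[X]) ^ m • z = 0) :
    Nonempty (M ≃ₗ[K[X]] K[X] ⧸ Ideal.span {(X : K[X]) ^ Module.finrank K M}) := by
  classical
  have : Module.Finite K[X] M := Module.Finite.of_restrictScalars_finite K K[X] M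
  have htors : Module.IsTorsion K[X] M := fun {z} ↦
    ⟨⟨X ^ m, mem_nonZeroDivisors_of_ne_zero (pow_ne_zero _ X_ne_zero)⟩, hm z⟩
  obtain ⟨ι, _, p, -, e, ⟨φ⟩⟩ := Module.equiv_directSum_of_isTorsion htors
  have hD := hM.of_bijective φ.symm.toLinearMap φ.symm.bijective
  obtain ⟨i, hi⟩ := hD.exists_bijective_component
  let ψ : M ≃ₗ[K[X]] K[X] ⧸ K[X] ∙ p i ^ e i :=
    φ.trans (LinearEquiv.ofBijective _ hi)
  have hdvd : p i ^ e i ∣ X ^ m := by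
    obtain ⟨z, hz⟩ := ψ.surjective (Submodule.Quotient.mk 1)
    have h1 := congrArg ψ (hm z)
    rw [map_smul, hz, map_zero, ← Submodule.Quotient.mk_smul, Submodule.Quotient.mk_eq_zero,
      smul_eq_mul, mul_one] at h1
    exact Ideal.mem_span_singleton.1 h1
  obtain ⟨j, -, hj⟩ := (dvd_prime_pow prime_X m).1 hdvd
  have hspan : (K[X] ∙ p i ^ e i) = Ideal.span {(X : K[X]) ^ j} :=
    Ideal.span_singleton_eq_span_singleton.2 hj
  let χ := ψ.trans (Submodule.quotEquivOfEq _ _ hspan)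
  have hfr : Module.finrank K M = j := by
    rw [(χ.restrictScalars K).finrank_eq]
    exact finrank_quotient_span_eq_natDegree.trans (natDegree_X_pow j)
  rw [hfr]
  exact ⟨χ⟩

open Polynomial in
theorem hasFiniteRepresentationType_of_algEquiv {K E : Type} [Field K] [Ring E] [Algebra K E]
    {m : ℕ} (θ : E ≃ₐ[K] K[X] ⧸ Ideal.span {(X : K[X]) ^ m}) :
    HasFiniteRepresentationType K E := by
  let x : Eᵐᵒᵖ := MulOpposite.op (θ.symm (Ideal.Quotient.mk _ X))
  let f : K[X] →ₐ[K] Eᵐᵒᵖ := aeval x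
  have hf (q : K[X]) : f q = MulOpposite.op (θ.symm (Ideal.Quotient.mk _ q)) := by
    let θ' : K[X] →ₐ[K] E := θ.symm.toAlgHom.comp (Ideal.Quotient.mkₐ K _)
    let g : K[X] →ₐ[K] Eᵐᵒᵖ := θ'.toOpposite fun a b ↦ by
      rw [Commute, SemiconjBy, ← map_mul, mul_comm, map_mul]
    have : f = g := by
      ext
      simp [f, x, g, θ']
    exact this ▸ rfl
  have hsurj : Function.Surjective f := fun r ↦ by
    obtain ⟨q, hq⟩ := Ideal.Quotient.mk_surjective (θ r.unop)
    exact ⟨q, by rw [hf, hq]; simp⟩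
  have hX : f (X ^ m) = 0 := by
    rw [hf, Ideal.Quotient.eq_zero_iff_mem.2 (Ideal.mem_span_singleton_self _)]
    simp
  have : RingHomSurjective f.toRingHom := ⟨hsurj⟩
  have key (M : FDRightModule K E) (hM : IsIndecomposableModule Eᵐᵒᵖ M.carrier) :
      letI : Module K[X] M.carrier := Module.compHom _ f.toRingHom
      Module.finrank K M.carrier ≤ m ∧ Nonempty (M.carrier ≃ₗ[K[X]]
        K[X] ⧸ Ideal.span {(X : K[X]) ^ Module.finrank K M.carrier}) := by
    let _ : Module K[X] M.carrier := Module.compHom _ f.toRingHom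
    have hsmul (q : K[X]) (z : M.carrier) : q • z = f q • z := rfl
    have : IsScalarTower K K[X] M.carrier := ⟨fun k q z ↦ by
      rw [hsmul, hsmul, map_smul, smul_assoc]⟩
    have hm (z : M.carrier) : (X : K[X]) ^ m • z = 0 := by rw [hsmul, hX, zero_smul]
    let id' : M.carrier →ₛₗ[f.toRingHom] M.carrier :=
      { toFun := id, map_add' := fun _ _ ↦ rfl, map_smul' := fun _ _ ↦ rfl }
    obtain ⟨e⟩ := (hM.of_bijective id' Function.bijective_id).nonempty_equiv_quotient_X_pow hm
    refine ⟨?_, ⟨e⟩⟩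
    have h1 : (X : K[X]) ^ m • e.symm (Ideal.Quotient.mk _ 1) = 0 := hm _
    rw [← map_smul, LinearEquiv.map_eq_zero_iff] at h1
    change Ideal.Quotient.mk _ (X ^ m * 1) = 0 at h1
    rw [mul_one] at h1
    exact (pow_dvd_pow_iff X_ne_zero not_isUnit_X).1
      (Ideal.mem_span_singleton.1 (Ideal.Quotient.eq_zero_iff_mem.1 h1))
  refine Finite.of_injective (β := Fin (m + 1)) (fun q ↦ ⟨indecomposableFinrank K E q, ?_⟩) ?_
  · obtain ⟨⟨M, hM⟩, rfl⟩ := Quot.exists_rep q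
    exact Nat.lt_succ_of_le (key M hM).1
  · intro q₁ q₂ h
    obtain ⟨⟨M, hM⟩, rfl⟩ := Quot.exists_rep q₁
    obtain ⟨⟨N, hN⟩, rfl⟩ := Quot.exists_rep q₂
    have hd : Module.finrank K M.carrier = Module.finrank K N.carrier := congrArg Fin.val h
    let _ : Module K[X] M.carrier := Module.compHom _ f.toRingHom
    let _ : Module K[X] N.carrier := Module.compHom _ f.toRingHom
    obtain ⟨e₁⟩ := (key M hM).2
    obtain ⟨e₂⟩ := (key N hN).2
    rw [← hd] at e₂
    let e := e₁.trans e₂.symm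
    refine Quot.sound ⟨{ e.toAddEquiv with map_smul' := fun r z ↦ ?_ }⟩
    obtain ⟨q, rfl⟩ := hsurj r
    exact e.map_smul q z

end FiniteType

open Polynomial in
theorem end_of_projective_finite_representation_type_iff
    (K A : Type) [Field K] [Ring A] [Algebra K A] [FiniteDimensional K A]
    (hsplit : IsSplittingFieldFor K A)
    (P : Type) [AddCommGroup P] [Module K P] [Module Aᵐᵒᵖ P] [IsScalarTower K Aᵐᵒᵖ P]
    (hproj : Module.Projective Aᵐᵒᵖ P)
    (hindec : IsIndecomposableModule Aᵐᵒᵖ P) :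
    HasFiniteRepresentationType K (Module.End Aᵐᵒᵖ P) ↔
      ∃ m : ℕ, 1 ≤ m ∧
        Nonempty (Module.End Aᵐᵒᵖ P ≃ₐ[K] K[X] ⧸ Ideal.span {(X : K[X]) ^ m}) := by
  obtain ⟨hfd, ε, hε⟩ := hindec.exists_augmentation hsplit
  have := hindec.1
  refine ⟨fun h ↦ ?_, fun ⟨m, _, ⟨θ⟩⟩ ↦ hasFiniteRepresentationType_of_algEquiv θ⟩
  obtain ⟨x, hx, htop⟩ | ⟨α, β, x, y, hα, hβ, hαx, hαy, hβx, hβy, hx, hy⟩ :=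
    exists_adjoin_eq_top_or_exists_derivations ε hε
  · exact nonempty_algEquiv_quotient_X_pow hx htop
  · exact absurd h
      (not_hasFiniteRepresentationType_of_derivations ε α β hα hβ hαx hαy hβx hβy hx hy)
end

section
/- Let K be a field, let q ∈ K have multiplicative order e (possibly infinite), and let f be an integer with 0 ≤ f and 2f ≤ e. Then for every n ≥ 1 the Iwahori–Hecke algebra H_q(B_n) is a symmetric algebra: there exists a K-linear map τ : H_q(B_n) → K such that τ(ab) = τ(ba) for all a, b ∈ H_q(B_n) and the bilinear form (a, b) ↦ τ(ab) is nondegenerate. -/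
/-- The multiplicative order of an element, valued in `ℕ∞`, with `⊤` for infinite order. -/
noncomputable def multOrder {M : Type*} [Monoid M] (x : M) : ℕ∞ :=
  if orderOf x = 0 then ⊤ else (orderOf x : ℕ∞)
/-- The defining relations of the Iwahori--Hecke algebra of type `Bₙ` with generators
`T_0, …, T_{n-1}`, where `T_0` satisfies `(T_0 - α)(T_0 - β) = 0` and the other
generators satisfy `(T_i + 1)(T_i - q) = 0`. -/
inductive HeckeBRel (K : Type) [Field K] (α β q : K) (n : ℕ) :
    FreeAlgebra K (Fin n) → FreeAlgebra K (Fin n) → Prop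
  | quad_zero (i : Fin n) (hi : (i : ℕ) = 0) :
      HeckeBRel K α β q n
        ((FreeAlgebra.ι K i - algebraMap K (FreeAlgebra K (Fin n)) α) *
          (FreeAlgebra.ι K i - algebraMap K (FreeAlgebra K (Fin n)) β)) 0
  | quad (i : Fin n) (hi : 0 < (i : ℕ)) :
      HeckeBRel K α β q n
        ((FreeAlgebra.ι K i + 1) * (FreeAlgebra.ι K i - algebraMap K (FreeAlgebra K (Fin n)) q)) 0
  | braid_zero (i j : Fin n) (hi : (i : ℕ) = 0) (hj : (j : ℕ) = 1) :
      HeckeBRel K α β q n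
        (FreeAlgebra.ι K i * FreeAlgebra.ι K j * FreeAlgebra.ι K i * FreeAlgebra.ι K j)
        (FreeAlgebra.ι K j * FreeAlgebra.ι K i * FreeAlgebra.ι K j * FreeAlgebra.ι K i)
  | braid (i j : Fin n) (hi : 0 < (i : ℕ)) (hij : (j : ℕ) = (i : ℕ) + 1) :
      HeckeBRel K α β q n
        (FreeAlgebra.ι K j * FreeAlgebra.ι K i * FreeAlgebra.ι K j)
        (FreeAlgebra.ι K i * FreeAlgebra.ι K j * FreeAlgebra.ι K i)
  | comm (i j : Fin n) (hij : (i : ℕ) + 1 < (j : ℕ)) :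
      HeckeBRel K α β q n (FreeAlgebra.ι K i * FreeAlgebra.ι K j)
        (FreeAlgebra.ι K j * FreeAlgebra.ι K i)

/-- The Iwahori--Hecke algebra of type `Bₙ`: the quotient of the free algebra on
`T_0, …, T_{n-1}` by the two-sided ideal generated by the defining relations, where
`T_0` satisfies `(T_0 - α)(T_0 - β) = 0`. -/
abbrev HeckeB (K : Type) [Field K] (α β q : K) (n : ℕ) : Type := RingQuot (HeckeBRel K α β q n)

/-- The braid relations of type `B` among the first `N` terms of a sequence. -/
structure IsBraidedB {M : Type*} [Monoid M] (T : ℕ → M) (N : ℕ) : Prop where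
  comm : ∀ i j, i + 1 < j → j < N → T i * T j = T j * T i
  braid : ∀ i, 0 < i → i + 1 < N → T (i + 1) * T i * T (i + 1) = T i * T (i + 1) * T i
  braid_zero : 1 < N → T 0 * T 1 * T 0 * T 1 = T 1 * T 0 * T 1 * T 0

/-- The product of the first `k` factors of `T m, …, T 1, T 0, T 1, …, T m`. -/
def zigzag {M : Type*} [Monoid M] (T : ℕ → M) (m : ℕ) : ℕ → M
  | 0 => 1
  | k + 1 => zigzag T m k * T ((m : ℤ) - k).natAbs

namespace IsBraidedB

variable {M : Type*} [Monoid M] {T : ℕ → M} {N : ℕ}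

theorem commute (h : IsBraidedB T N) {i j : ℕ} (hi : i < N) (hj : j < N)
    (hij : i + 1 < j ∨ j + 1 < i) : Commute (T i) (T j) := by
  rcases hij with hij | hij
  · exact h.comm i j hij hj
  · exact (h.comm j i hij hi).symm

theorem zigzag_mul_of_add_lt (h : IsBraidedB T N) {m : ℕ} (hm : m < N) {i k : ℕ}
    (hik : i + k < m) : zigzag T m k * T i = T i * zigzag T m k := by
  induction k with
  | zero => simp [zigzag]
  | succ k ih =>
    have hc : Commute (T ((m : ℤ) - k).natAbs) (T i) := h.commute (by omega) (by omega) (by omega)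
    rw [zigzag, mul_assoc, hc.eq, ← mul_assoc, ih (by omega), mul_assoc]

theorem zigzag_mul_of_lt_add (h : IsBraidedB T N) {m : ℕ} (hm : m < N) {i k : ℕ}
    (hi : i + 1 ≤ m) (hi0 : 0 < i) (hk : m + 1 ≤ i + k) (hk' : k ≤ m + i) :
    zigzag T m k * T (i + 1) = T i * zigzag T m k := by
  obtain ⟨d, rfl⟩ : ∃ d, k = (m - i - 1) + 2 + d := ⟨k - (m - i - 1) - 2, by omega⟩
  clear hk
  induction d with
  | zero =>
    have h1 : ((m : ℤ) - (m - i - 1 : ℕ)).natAbs = i + 1 := by omega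
    have h2 : ((m : ℤ) - (m - i - 1 + 1 : ℕ)).natAbs = i := by omega
    have h3 := h.zigzag_mul_of_add_lt hm (i := i) (k := m - i - 1) (by omega)
    simp only [zigzag, h1, h2]
    calc _ = zigzag T m (m - i - 1) * (T (i + 1) * T i * T (i + 1)) := by simp only [mul_assoc]
      _ = zigzag T m (m - i - 1) * T i * T (i + 1) * T i := by
        rw [h.braid i hi0 (by omega)]; simp only [mul_assoc]
      _ = _ := by rw [h3]; simp only [mul_assoc]
  | succ d ih =>
    have hc : Commute (T ((m : ℤ) - (m - i - 1 + 2 + d : ℕ)).natAbs) (T (i + 1)) :=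
      h.commute (by omega) (by omega) (by omega)
    rw [← add_assoc, zigzag, mul_assoc, hc.eq, ← mul_assoc, ih (by omega), mul_assoc]

theorem zigzag_mul_of_add_le (h : IsBraidedB T N) {m : ℕ} (hm : m < N) {i k : ℕ}
    (hk : m + i + 2 ≤ k) (hk' : k ≤ 2 * m + 1) :
    zigzag T m k * T i = T i * zigzag T m k := by
  obtain ⟨d, rfl⟩ : ∃ d, k = m + i + 2 + d := ⟨k - (m + i + 2), by omega⟩
  clear hk
  induction d with
  | zero =>
    rcases Nat.eq_zero_or_pos i with rfl | hi
    · obtain ⟨m, rfl⟩ : ∃ l, m = l + 1 := ⟨m - 1, by omega⟩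
      have h1 : (((m + 1 : ℕ) : ℤ) - (m : ℕ)).natAbs = 1 := by omega
      have h2 : (((m + 1 : ℕ) : ℤ) - (m + 1 : ℕ)).natAbs = 0 := by omega
      have h3 : (((m + 1 : ℕ) : ℤ) - (m + 1 + 1 : ℕ)).natAbs = 1 := by omega
      have h4 := h.zigzag_mul_of_add_lt hm (i := 0) (k := m) (by omega)
      simp only [zigzag, h1, h2, h3]
      calc _ = zigzag T (m + 1) m * (T 1 * T 0 * T 1 * T 0) := by simp only [mul_assoc]
        _ = zigzag T (m + 1) m * T 0 * T 1 * T 0 * T 1 := by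
          rw [← h.braid_zero (by omega)]; simp only [mul_assoc]
        _ = _ := by rw [h4]; simp only [mul_assoc]
    · have h1 : ((m : ℤ) - (m + i : ℕ)).natAbs = i := by omega
      have h2 : ((m : ℤ) - (m + i + 1 : ℕ)).natAbs = i + 1 := by omega
      have h3 := h.zigzag_mul_of_lt_add hm (i := i) (k := m + i) (by omega) hi (by omega) (by omega)
      simp only [zigzag, h1, h2]
      calc _ = zigzag T m (m + i) * (T i * T (i + 1) * T i) := by simp only [mul_assoc]
        _ = zigzag T m (m + i) * T (i + 1) * T i * T (i + 1) := by
          rw [← h.braid i hi (by omega)]; simp only [mul_assoc]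
        _ = _ := by rw [h3]; simp only [mul_assoc]
  | succ d ih =>
    have hc : Commute (T ((m : ℤ) - (m + i + 2 + d : ℕ)).natAbs) (T i) :=
      h.commute (by omega) (by omega) (by omega)
    rw [← add_assoc, zigzag, mul_assoc, hc.eq, ← mul_assoc, ih (by omega), mul_assoc]

end IsBraidedB

/-- The span of all products of one initial piece of each zigzag word of level less than `m`. -/
noncomputable def zigzagSpan (K : Type*) {A : Type*} [Field K] [Ring A] [Algebra K A]
    (T : ℕ → A) : ℕ → Submodule K A
  | 0 => Submodule.span K {1}
  | m + 1 => ⨆ k : Fin (2 * m + 2), (zigzagSpan K T m).map (LinearMap.mulRight K (zigzag T m k))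

section Span

variable {K A : Type*} [Field K] [Ring A] [Algebra K A] (T : ℕ → A)

theorem mul_zigzag_mem {m k : ℕ} (hk : k < 2 * m + 2) {x : A} (hx : x ∈ zigzagSpan K T m) :
    x * zigzag T m k ∈ zigzagSpan K T (m + 1) :=
  Submodule.mem_iSup_of_mem (⟨k, hk⟩ : Fin (2 * m + 2)) ⟨x, hx, rfl⟩

theorem one_mem_zigzagSpan (m : ℕ) : (1 : A) ∈ zigzagSpan K T m := by
  induction m with
  | zero => exact Submodule.mem_span_singleton_self 1
  | succ m ih => simpa [zigzag] using mul_zigzag_mem T (k := 0) (by omega) ih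

theorem mul_mem_zigzagSpan {T : ℕ → A} {N : ℕ} (h : IsBraidedB T N) {a b : ℕ → K}
    (hquad : ∀ i < N, T i * T i = a i • T i + b i • 1) {m : ℕ} (hm : m ≤ N) {i : ℕ} (hi : i < m)
    {x : A} (hx : x ∈ zigzagSpan K T m) : x * T i ∈ zigzagSpan K T m := by
  induction m generalizing i x with
  | zero => omega
  | succ m ih =>
    have hm' : m < N := by omega
    suffices (zigzagSpan K T (m + 1)).map (LinearMap.mulRight K (T i)) ≤ zigzagSpan K T (m + 1) from
      this ⟨x, hx, rfl⟩
    conv_lhs => rw [zigzagSpan]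
    rw [Submodule.map_iSup, iSup_le_iff]
    rintro ⟨k, hk⟩ _ ⟨_, ⟨y, hy, rfl⟩, rfl⟩
    simp only [LinearMap.mulRight_apply]
    have hquad' : ∀ l, l + 1 = k → ((m : ℤ) - l).natAbs = i →
        y * zigzag T m k * T i ∈ zigzagSpan K T (m + 1) := by
      rintro l rfl hl
      have e : y * zigzag T m (l + 1) * T i =
          a i • (y * zigzag T m (l + 1)) + b i • (y * zigzag T m l) := by
        rw [zigzag, hl, mul_assoc, mul_assoc, hquad i (by omega)]
        simp [mul_add]
      rw [e]
      exact add_mem (Submodule.smul_mem _ _ (mul_zigzag_mem T hk hy))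
        (Submodule.smul_mem _ _ (mul_zigzag_mem T (by omega) hy))
    have hnext : k < 2 * m + 1 → ((m : ℤ) - k).natAbs = i →
        y * zigzag T m k * T i ∈ zigzagSpan K T (m + 1) := by
      intro hk' hi'
      have := mul_zigzag_mem T (k := k + 1) (by omega) hy
      rwa [zigzag, hi', ← mul_assoc] at this
    have hcomm : ∀ j < m, zigzag T m k * T i = T j * zigzag T m k →
        y * zigzag T m k * T i ∈ zigzagSpan K T (m + 1) := by
      intro j hj e
      rw [mul_assoc, e, ← mul_assoc]
      exact mul_zigzag_mem T hk (ih (by omega) hj hy)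
    rcases lt_trichotomy (i + k) m with h1 | h1 | h1
    · exact hcomm i (by omega) (h.zigzag_mul_of_add_lt hm' h1)
    · exact hnext (by omega) (by omega)
    rcases eq_or_ne (i + k) (m + 1) with h2 | h2
    · by_cases hk0 : k = 0
      · omega
      · exact hquad' (k - 1) (by omega) (by omega)
    rcases lt_trichotomy k (m + i) with h3 | h3 | h3
    · obtain ⟨i, rfl⟩ : ∃ j, i = j + 1 := ⟨i - 1, by omega⟩
      exact hcomm i (by omega)
        (h.zigzag_mul_of_lt_add hm' (by omega) (by omega) (by omega) (by omega))
    · exact hnext (by omega) (by omega)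
    rcases eq_or_ne k (m + i + 1) with h4 | h4
    · exact hquad' (k - 1) (by omega) (by omega)
    · exact hcomm i (by omega) (h.zigzag_mul_of_add_le hm' (by omega) (by omega))

theorem finite_zigzagSpan (m : ℕ) : Module.Finite K (zigzagSpan K T m) := by
  induction m with
  | zero => rw [zigzagSpan]; infer_instance
  | succ m ih => rw [zigzagSpan]; infer_instance

theorem Submodule.finrank_iSup_le_sum {K V ι : Type*} [Field K] [AddCommGroup V] [Module K V]
    [Fintype ι] (p : ι → Submodule K V) [∀ i, Module.Finite K (p i)] :
    Module.finrank K (⨆ i, p i : Submodule K V) ≤ ∑ i, Module.finrank K (p i) := by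
  classical
  have key : ∀ t : Finset ι,
      Module.finrank K (t.sup p : Submodule K V) ≤ ∑ i ∈ t, Module.finrank K (p i) := by
    intro t
    induction t using Finset.induction_on with
    | empty => simp
    | insert i t hi ih =>
      rw [Finset.sup_insert, Finset.sum_insert hi]
      exact (Submodule.finrank_add_le_finrank_add_finrank _ _).trans (Nat.add_le_add_left ih _)
  rw [← Finset.sup_univ_eq_iSup]
  exact key Finset.univ

theorem finrank_zigzagSpan_le (m : ℕ) :
    Module.finrank K (zigzagSpan K T m) ≤ ∏ l ∈ Finset.range m, (2 * l + 2) := by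
  induction m with
  | zero =>
    rw [zigzagSpan]
    exact (finrank_span_le_card _).trans (by simp)
  | succ m ih =>
    have := finite_zigzagSpan (K := K) T m
    rw [zigzagSpan, Finset.prod_range_succ]
    calc _ ≤ _ := Submodule.finrank_iSup_le_sum _
      _ ≤ ∑ _k : Fin (2 * m + 2), ∏ l ∈ Finset.range m, (2 * l + 2) :=
        Finset.sum_le_sum fun k _ => (Submodule.finrank_map_le _ _).trans ih
      _ = _ := by simp [mul_comm]

theorem zigzagSpan_eq_top {T : ℕ → A} {N : ℕ} (h : IsBraidedB T N) {a b : ℕ → K}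
    (hquad : ∀ i < N, T i * T i = a i • T i + b i • 1)
    (hgen : Algebra.adjoin K (T '' Set.Iio N) = ⊤) : zigzagSpan K T N = ⊤ := by
  have key : ∀ x ∈ Algebra.adjoin K (T '' Set.Iio N), ∀ y ∈ zigzagSpan K T N,
      y * x ∈ zigzagSpan K T N := by
    intro x hx
    induction hx using Algebra.adjoin_induction with
    | mem x hx =>
      obtain ⟨i, hi, rfl⟩ := hx
      exact fun y hy => mul_mem_zigzagSpan h hquad le_rfl hi hy
    | algebraMap c =>
      intro y hy
      rw [← Algebra.commutes, ← Algebra.smul_def]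
      exact Submodule.smul_mem _ _ hy
    | add x x' _ _ hx hx' => exact fun y hy => by rw [mul_add]; exact add_mem (hx y hy) (hx' y hy)
    | mul x x' _ _ hx hx' => exact fun y hy => by rw [← mul_assoc]; exact hx' _ (hx y hy)
  refine eq_top_iff.2 fun x _ => ?_
  simpa using key x (by rw [hgen]; trivial) 1 (one_mem_zigzagSpan T N)

end Span

/-- A group generated by involutions `s i`, with a left descent relation `D` satisfying the
root-theoretic exchange property, and with quadratic parameters `a i`, `b i` constant along
conjugate generators. -/
structure DescentDatum (K : Type*) [Field K] {W ι : Type*} [Group W] (s : ι → W)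
    (D : ι → W → Prop) (a b : ι → K) : Prop where
  sq : ∀ i, s i * s i = 1
  not_one : ∀ i, ¬ D i 1
  simple_mul : ∀ i w, D i (s i * w) ↔ ¬ D i w
  exchange : ∀ i j w, (D i (w * s j) ↔ D i w) ∨
    (s i * w = w * s j ∧ (D i w ↔ D j w⁻¹) ∧ a i = a j ∧ b i = b j)
  generate : Subgroup.closure (Set.range s) = ⊤
  ne_zero : ∀ i, b i ≠ 0

open Finsupp in
open scoped Classical in
/-- Left multiplication by a generator on the standard basis of the Hecke algebra. -/
noncomputable def leftOp {K : Type*} [Field K] {W ι : Type*} [Group W] (s : ι → W)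
    (D : ι → W → Prop) (a b : ι → K) (i : ι) : Module.End K (W →₀ K) :=
  linearCombination K fun w =>
    if D i w then single (s i * w) (b i) + single w (a i) else single (s i * w) 1

open Finsupp in
open scoped Classical in
/-- Right multiplication by a generator on the standard basis of the Hecke algebra. -/
noncomputable def rightOp {K : Type*} [Field K] {W ι : Type*} [Group W] (s : ι → W)
    (D : ι → W → Prop) (a b : ι → K) (i : ι) : Module.End K (W →₀ K) :=
  linearCombination K fun w =>
    if D i w⁻¹ then single (w * s i) (b i) + single w (a i) else single (w * s i) 1

namespace DescentDatum

open Finsupp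

variable {K : Type*} [Field K] {W ι : Type*} [Group W] {s : ι → W} {D : ι → W → Prop}
  {a b : ι → K}

theorem inv_eq (h : DescentDatum K s D a b) (i : ι) : (s i)⁻¹ = s i :=
  inv_eq_of_mul_eq_one_right (h.sq i)

theorem mul_simple (h : DescentDatum K s D a b) (i : ι) (w : W) :
    D i (w * s i)⁻¹ ↔ ¬ D i w⁻¹ := by
  rw [mul_inv_rev, h.inv_eq, h.simple_mul]

theorem leftOp_single_of_not {i : ι} {w : W} (hw : ¬ D i w) (c : K) :
    leftOp s D a b i (single w c) = single (s i * w) c := by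
  simp [leftOp, hw]

theorem leftOp_single_of {i : ι} {w : W} (hw : D i w) (c : K) :
    leftOp s D a b i (single w c) = single (s i * w) (c * b i) + single w (c * a i) := by
  simp [leftOp, hw]

theorem rightOp_single_of_not {i : ι} {w : W} (hw : ¬ D i w⁻¹) (c : K) :
    rightOp s D a b i (single w c) = single (w * s i) c := by
  simp [rightOp, hw]

theorem rightOp_single_of {i : ι} {w : W} (hw : D i w⁻¹) (c : K) :
    rightOp s D a b i (single w c) = single (w * s i) (c * b i) + single w (c * a i) := by
  simp [rightOp, hw]

theorem commute (h : DescentDatum K s D a b) (i j : ι) :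
    Commute (leftOp s D a b i) (rightOp s D a b j) := by
  have main : ∀ w, leftOp s D a b i (rightOp s D a b j (single w 1)) =
      rightOp s D a b j (leftOp s D a b i (single w 1)) := by
    intro w
    have twist : (s i * w = w * s j ∧ (D i w ↔ D j w⁻¹) ∧ a i = a j ∧ b i = b j) →
        leftOp s D a b i (rightOp s D a b j (single w 1)) =
        rightOp s D a b j (leftOp s D a b i (single w 1)) := by
      rintro ⟨e, hD, ha, hb⟩
      have hi : D i (w * s j) ↔ ¬ D i w := by rw [← e, h.simple_mul]
      have hj := h.mul_simple j w
      have e1 : s i * (w * s j) = w := by rw [← e, ← mul_assoc, h.sq, one_mul]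
      have e2 : w * s j * s j = w := by rw [mul_assoc, h.sq, mul_one]
      by_cases hw : D i w
      · have hw' := hD.1 hw
        have hi' : ¬ D i (w * s j) := by tauto
        have hj' : ¬ D j (w * s j)⁻¹ := by tauto
        simp only [leftOp_single_of hw, rightOp_single_of hw', map_add, leftOp_single_of_not hi', e,
          rightOp_single_of_not hj', e1, e2, ha, hb]
      · have hw' : ¬ D j w⁻¹ := by tauto
        have hi' : D i (w * s j) := by tauto
        have hj' : D j (w * s j)⁻¹ := by tauto
        simp only [leftOp_single_of_not hw, rightOp_single_of_not hw', leftOp_single_of hi', e,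
          rightOp_single_of hj', e1, e2, ha, hb]
    rcases h.exchange i j w with hi | hi
    swap
    · exact twist hi
    rcases h.exchange j i w⁻¹ with hj | ⟨e, hD, ha, hb⟩
    swap
    · refine twist ⟨?_, ?_, ha.symm, hb.symm⟩
      · have := congrArg (·⁻¹) e
        simpa [h.inv_eq] using this.symm
      · rw [hD, inv_inv]
    have hj' : D j (s i * w)⁻¹ ↔ D j w⁻¹ := by rw [mul_inv_rev, h.inv_eq, hj]
    by_cases hw : D i w <;> by_cases hw' : D j w⁻¹
    · have hi1 := hi.2 hw
      have hj1 := hj'.2 hw'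
      simp only [leftOp_single_of hw, rightOp_single_of hw', map_add, leftOp_single_of hi1,
        rightOp_single_of hj1, mul_assoc, one_mul, mul_comm (b i), mul_comm (a i)]
      abel
    · have hi1 := hi.2 hw
      have hj1 := mt hj'.1 hw'
      simp only [leftOp_single_of hw, rightOp_single_of_not hw', map_add, leftOp_single_of hi1,
        rightOp_single_of_not hj1, mul_assoc]
    · have hi1 := mt hi.1 hw
      have hj1 := hj'.2 hw'
      simp only [leftOp_single_of_not hw, rightOp_single_of hw', map_add, leftOp_single_of_not hi1,
        rightOp_single_of hj1, mul_assoc]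
    · have hi1 := mt hi.1 hw
      have hj1 := mt hj'.1 hw'
      simp only [leftOp_single_of_not hw, rightOp_single_of_not hw', leftOp_single_of_not hi1,
        rightOp_single_of_not hj1, mul_assoc]
  refine LinearMap.ext fun v => ?_
  induction v using Finsupp.induction_linear with
  | zero => simp
  | add v v' hv hv' => simp only [map_add, hv, hv']
  | single w c =>
    have e : (single w c : W →₀ K) = c • single w 1 := by rw [smul_single, smul_eq_mul, mul_one]
    simp only [e, map_smul, Module.End.mul_apply, main]

/-- Induction along right multiplication by generators. -/
theorem induction_right (h : DescentDatum K s D a b) {p : W → Prop} (one : p 1)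
    (mul : ∀ w i, p w → p (w * s i)) (w : W) : p w := by
  have hw : w ∈ Subgroup.closure (Set.range s) := by rw [h.generate]; trivial
  induction hw using Subgroup.closure_induction_right with
  | one => exact one
  | mul_right x hx y hy ih => obtain ⟨i, rfl⟩ := hy; exact mul _ _ ih
  | mul_inv_cancel x hx y hy ih => obtain ⟨i, rfl⟩ := hy; rw [h.inv_eq]; exact mul _ _ ih

theorem eq_top_of_rightOp_mem (h : DescentDatum K s D a b) {S : Submodule K (W →₀ K)}
    (one : single 1 1 ∈ S) (mem : ∀ i, ∀ v ∈ S, rightOp s D a b i v ∈ S) : S = ⊤ := by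
  have key : ∀ w, single w 1 ∈ S := by
    refine fun w => h.induction_right (p := fun w => single w 1 ∈ S) one (fun w i hw => ?_) w
    have := mem i _ hw
    by_cases hD : D i w⁻¹
    · rw [rightOp_single_of hD] at this
      have h2 : single w (1 * a i) ∈ S := by
        simpa using S.smul_mem (a i) hw
      have h3 := S.smul_mem (b i)⁻¹ ((S.add_mem_iff_left h2).1 this)
      simpa [h.ne_zero i] using h3
    · rwa [rightOp_single_of_not hD] at this
  refine eq_top_iff.2 fun v _ => ?_
  induction v using Finsupp.induction_linear with
  | zero => exact S.zero_mem
  | add v v' hv hv' => exact S.add_mem (hv trivial) (hv' trivial)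
  | single w c => simpa using S.smul_mem c (key w)

theorem ext_of_commute (h : DescentDatum K s D a b) {X Y : Module.End K (W →₀ K)}
    (hX : ∀ i, Commute X (rightOp s D a b i)) (hY : ∀ i, Commute Y (rightOp s D a b i))
    (hXY : X (single 1 1) = Y (single 1 1)) : X = Y := by
  rw [← LinearMap.eqLocus_eq_top]
  refine h.eq_top_of_rightOp_mem hXY fun i v hv => ?_
  have h1 := LinearMap.congr_fun (hX i) v
  have h2 := LinearMap.congr_fun (hY i) v
  simp only [Module.End.mul_apply] at h1 h2
  rw [LinearMap.mem_eqLocus] at hv ⊢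
  rw [h1, h2, hv]

theorem leftOp_one (h : DescentDatum K s D a b) (i : ι) :
    leftOp s D a b i (single 1 1) = single (s i) 1 := by
  rw [leftOp_single_of_not (h.not_one i), mul_one]

theorem rightOp_one (h : DescentDatum K s D a b) (i : ι) :
    rightOp s D a b i (single 1 1) = single (s i) 1 := by
  rw [rightOp_single_of_not (by simpa using h.not_one i), one_mul]

theorem leftOp_mul_self (h : DescentDatum K s D a b) (i : ι) :
    leftOp s D a b i * leftOp s D a b i = a i • leftOp s D a b i + b i • 1 := by
  have hc := fun j => h.commute i j
  refine h.ext_of_commute (fun j => (hc j).mul_left (hc j))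
    (fun j => ((hc j).smul_left _).add_left ((Commute.one_left _).smul_left _)) ?_
  have hD : D i (s i) := by simpa using (h.simple_mul i 1).2 (h.not_one i)
  simp only [Module.End.mul_apply, LinearMap.add_apply, LinearMap.smul_apply, h.leftOp_one,
    Module.End.one_apply, leftOp_single_of hD, h.sq, smul_single, smul_eq_mul, mul_one, one_mul]
  rw [add_comm]

theorem leftOp_apply_one (h : DescentDatum K s D a b) (i : ι) (v : W →₀ K) :
    leftOp s D a b i v 1 = rightOp s D a b i v 1 := by
  induction v using Finsupp.induction_linear with
  | zero => simp
  | add v v' hv hv' => simp only [map_add, Finsupp.add_apply, hv, hv']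
  | single w c =>
    classical
    have hs : D i (s i) := by simpa using (h.simple_mul i 1).2 (h.not_one i)
    by_cases hw : w = s i
    · subst hw
      rw [leftOp_single_of hs, rightOp_single_of (by rwa [h.inv_eq])]
    · have h1 : s i * w ≠ 1 := fun e => hw (by rw [← h.inv_eq]; exact (inv_eq_of_mul_eq_one_right e).symm)
      have h2 : w * s i ≠ 1 := fun e => hw (by rw [← h.inv_eq]; exact (eq_inv_of_mul_eq_one_left e))
      by_cases hw1 : w = 1
      · subst hw1
        rw [leftOp_single_of_not (h.not_one i),
          rightOp_single_of_not (by simpa using h.not_one i), mul_one, one_mul]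
      · by_cases hD : D i w <;> by_cases hD' : D i w⁻¹ <;>
        simp [leftOp_single_of, leftOp_single_of_not, rightOp_single_of, rightOp_single_of_not,
          hD, hD', h1, h2, hw1]

open scoped Classical in
theorem rightOp_apply (h : DescentDatum K s D a b) (i : ι) (v : W →₀ K) (w : W) :
    rightOp s D a b i v w =
      (if D i w⁻¹ then 1 else b i) * v (w * s i) + (if D i w⁻¹ then a i else 0) * v w := by
  induction v using Finsupp.induction_linear with
  | zero => simp
  | add v v' hv hv' => simp only [map_add, Finsupp.add_apply, hv, hv']; ring
  | single x c =>
    have hx := h.mul_simple i x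
    have hw := h.mul_simple i w
    have e : x * s i = w ↔ x = w * s i := by
      constructor
      · rintro rfl; rw [mul_assoc, h.sq, mul_one]
      · rintro rfl; rw [mul_assoc, h.sq, mul_one]
    have ne : w * s i ≠ w := by
      intro e'; rw [e'] at hw; tauto
    by_cases hD : D i x⁻¹
    · rw [rightOp_single_of hD]
      simp only [Finsupp.add_apply, Finsupp.single_apply, e]
      by_cases h1 : x = w * s i
      · subst h1
        simp [hw.1 hD, ne, mul_comm]
      · by_cases h2 : x = w
        · subst h2; simp [hD, ne.symm, mul_comm]
        · simp [h1, h2]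
    · rw [rightOp_single_of_not hD]
      simp only [Finsupp.single_apply, e]
      by_cases h1 : x = w * s i
      · subst h1
        have : D i w⁻¹ := by tauto
        simp [this, ne]
      · by_cases h2 : x = w
        · subst h2; simp [hD, ne.symm]
        · simp [h1, h2]

variable {H : Type*} [Ring H] [Algebra K H] {T : ι → H} {φ : H →ₐ[K] Module.End K (W →₀ K)}

theorem map_commute (h : DescentDatum K s D a b) (hT : Algebra.adjoin K (Set.range T) = ⊤)
    (hφ : ∀ i, φ (T i) = leftOp s D a b i) (x : H) (j : ι) :
    Commute (φ x) (rightOp s D a b j) := by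
  have hx : x ∈ Algebra.adjoin K (Set.range T) := by rw [hT]; trivial
  induction hx using Algebra.adjoin_induction with
  | mem x hx => obtain ⟨i, rfl⟩ := hx; rw [hφ]; exact h.commute i j
  | algebraMap c => rw [AlgHom.commutes]; exact Algebra.commutes _ _
  | add x y _ _ hx hy => rw [map_add]; exact hx.add_left hy
  | mul x y _ _ hx hy => rw [map_mul]; exact hx.mul_left hy

theorem rightOp_map (h : DescentDatum K s D a b) (hT : Algebra.adjoin K (Set.range T) = ⊤)
    (hφ : ∀ i, φ (T i) = leftOp s D a b i) (x : H) (j : ι) :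
    rightOp s D a b j (φ x (single 1 1)) = φ (x * T j) (single 1 1) := by
  have := LinearMap.congr_fun (h.map_commute hT hφ x j) (single 1 1)
  simp only [Module.End.mul_apply] at this
  rw [← this, map_mul, Module.End.mul_apply, hφ, h.leftOp_one, h.rightOp_one]

theorem surjective (h : DescentDatum K s D a b) (hT : Algebra.adjoin K (Set.range T) = ⊤)
    (hφ : ∀ i, φ (T i) = leftOp s D a b i) :
    Function.Surjective ((LinearMap.applyₗ (single 1 1 : W →₀ K)).comp φ.toLinearMap) := by
  rw [← LinearMap.range_eq_top]
  refine h.eq_top_of_rightOp_mem ⟨1, by simp⟩ ?_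
  rintro i _ ⟨x, rfl⟩
  exact ⟨x * T i, (h.rightOp_map hT hφ x i).symm⟩

/-- The coefficient of the identity is a symmetrizing trace. -/
theorem exists_trace (h : DescentDatum K s D a b) (hT : Algebra.adjoin K (Set.range T) = ⊤)
    (hφ : ∀ i, φ (T i) = leftOp s D a b i)
    (hinj : Function.Injective ((LinearMap.applyₗ (single 1 1 : W →₀ K)).comp φ.toLinearMap)) :
    ∃ τ : H →ₗ[K] K, (∀ x y, τ (x * y) = τ (y * x)) ∧ ∀ x, (∀ y, τ (x * y) = 0) → x = 0 := by
  refine ⟨(lapply 1).comp ((LinearMap.applyₗ (single 1 1 : W →₀ K)).comp φ.toLinearMap), ?_, ?_⟩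
  · intro x
    have hx : x ∈ Algebra.adjoin K (Set.range T) := by rw [hT]; trivial
    induction hx using Algebra.adjoin_induction with
    | mem x hx =>
      obtain ⟨i, rfl⟩ := hx
      intro y
      have := h.leftOp_apply_one i (φ y (single 1 1))
      rw [h.rightOp_map hT hφ, ← hφ] at this
      simpa using this
    | algebraMap c => exact fun y => by rw [Algebra.commutes]
    | add x x' _ _ hx hx' => exact fun y => by rw [add_mul, mul_add, map_add, map_add, hx, hx']
    | mul x x' _ _ hx hx' => exact fun y => by rw [mul_assoc, hx, mul_assoc, hx', mul_assoc]
  · intro x hx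
    have key : ∀ w y, φ (x * y) (single 1 1) w = 0 := by
      intro w
      induction w using h.induction_right with
      | one => exact hx
      | mul w i hw =>
        intro y
        have h1 := h.rightOp_apply i (φ (x * y) (single 1 1)) w
        rw [h.rightOp_map hT hφ, mul_assoc, hw, hw, mul_zero, add_zero, eq_comm,
          mul_eq_zero] at h1
        refine h1.resolve_left ?_
        split_ifs
        exacts [one_ne_zero, h.ne_zero i]
    refine hinj ?_
    rw [map_zero]
    ext w
    simpa using key w 1

end DescentDatum

/-- The function underlying `signedSwap`. -/
def signedSwapFun (i : ℕ) (x : ℤ) : ℤ :=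
  if x = i then i - 1 else if x = i - 1 then i else if x = -i then -1 - i
  else if x = -1 - i then -i else x

theorem signedSwapFun_involutive (i : ℕ) : Function.Involutive (signedSwapFun i) := by
  intro x
  unfold signedSwapFun
  split_ifs <;> omega

/-- The generators of the group of signed permutations, acting on `ℤ` with `x ↦ -1 - x` as the
change of sign: `signedSwap i` exchanges `i - 1` with `i` and `-i` with `-1 - i`. -/
def signedSwap (i : ℕ) : Equiv.Perm ℤ := (signedSwapFun_involutive i).toPerm

theorem signedSwap_apply (i : ℕ) (x : ℤ) : signedSwap i x =
    if x = i then (i : ℤ) - 1 else if x = i - 1 then (i : ℤ) else if x = -i then -1 - i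
    else if x = -1 - i then -i else x := rfl

theorem signedSwap_mul_self (i : ℕ) : signedSwap i * signedSwap i = 1 :=
  Equiv.ext (signedSwapFun_involutive i)

theorem signedSwap_inv (i : ℕ) : (signedSwap i)⁻¹ = signedSwap i := rfl

theorem signedSwap_neg (i : ℕ) (x : ℤ) : signedSwap i (-1 - x) = -1 - signedSwap i x := by
  simp only [signedSwap_apply]
  split_ifs <;> omega

theorem signedSwap_order {j : ℕ} {x y : ℤ} (hxy : x < y) (h : signedSwap j y ≤ signedSwap j x) :
    (x = j - 1 ∧ y = j) ∨ (x = -1 - j ∧ y = -j) := by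
  simp only [signedSwap_apply] at h
  split_ifs at h <;> omega

theorem signedSwap_conj {i j : ℕ} {w : Equiv.Perm ℤ} (hw : ∀ x, w (-1 - x) = -1 - w x)
    (h : (w j = i ∧ w (j - 1) = i - 1) ∨ (w j = i - 1 ∧ w (j - 1) = i) ∨
      (w j = -i ∧ w (j - 1) = -1 - i) ∨ (w j = -1 - i ∧ w (j - 1) = -i)) :
    signedSwap i * w = w * signedSwap j ∧ (i = 0 ↔ j = 0) := by
  have h1 := hw j
  have h2 := hw (j - 1)
  rw [show (-1 : ℤ) - (j - 1) = -j by ring] at h2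
  have e : ∀ {x y}, w x = w y → x = y := fun h => w.injective h
  constructor
  · ext x
    rw [Equiv.Perm.mul_apply, Equiv.Perm.mul_apply, signedSwap_apply j]
    split_ifs with c1 c2 c3 c4
    · rw [c1, signedSwap_apply]
      split_ifs <;> omega
    · rw [c2, signedSwap_apply]
      split_ifs <;> omega
    · rw [c3, signedSwap_apply]
      split_ifs <;> omega
    · rw [c4, signedSwap_apply]
      split_ifs <;> omega
    · have a1 := mt (@e x j) c1
      have a2 := mt (@e x (j - 1)) c2
      have a3 := mt (@e x (-j)) c3
      have a4 := mt (@e x (-1 - j)) c4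
      rw [signedSwap_apply]
      split_ifs <;> omega
  · have a1 := @e j (-j)
    have a2 := @e j (j - 1)
    constructor
    · intro hi
      by_contra hj
      have a3 : w j ≠ w (-j) := fun h => by have := e h; omega
      omega
    · intro hj
      simp only [hj, Nat.cast_zero, neg_zero] at h h2
      omega

theorem signedSwap_comm {i j : ℕ} (h : i + 1 < j) :
    signedSwap i * signedSwap j = signedSwap j * signedSwap i := by
  refine (signedSwap_conj (signedSwap_neg j) (Or.inl ⟨?_, ?_⟩)).1 <;>
  · rw [signedSwap_apply]
    split_ifs <;> omega

theorem signedSwap_braid {i : ℕ} (h : 0 < i) :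
    signedSwap (i + 1) * signedSwap i * signedSwap (i + 1) =
      signedSwap i * signedSwap (i + 1) * signedSwap i := by
  have h1 : signedSwap i (i + 1 : ℕ) = (i + 1 : ℕ) := by
    rw [signedSwap_apply]; split_ifs <;> omega
  have h2 : signedSwap (i + 1) (i + 1 : ℕ) = i := by
    rw [signedSwap_apply]; split_ifs <;> omega
  have h3 : signedSwap i ((i + 1 : ℕ) - 1) = i - 1 := by
    rw [signedSwap_apply]; split_ifs <;> omega
  have h4 : signedSwap (i + 1) (i - 1) = i - 1 := by
    rw [signedSwap_apply]; split_ifs <;> omega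
  rw [mul_assoc (signedSwap i)]
  refine (signedSwap_conj (fun x => ?_) (Or.inl ⟨?_, ?_⟩)).1.symm
  · simp only [Equiv.Perm.mul_apply, signedSwap_neg]
  · rw [Equiv.Perm.mul_apply, h1, h2]
  · rw [Equiv.Perm.mul_apply, h3, h4]

theorem signedSwap_braid_zero :
    signedSwap 0 * signedSwap 1 * signedSwap 0 * signedSwap 1 =
      signedSwap 1 * signedSwap 0 * signedSwap 1 * signedSwap 0 := by
  rw [mul_assoc (signedSwap 0), mul_assoc (signedSwap 0)]
  refine (signedSwap_conj (fun x => ?_) (Or.inl ⟨?_, ?_⟩)).1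
  · simp only [Equiv.Perm.mul_apply, signedSwap_neg]
  · rfl
  · rfl

/-- The group of signed permutations generated by the first `n` generators. -/
def signedPerm (n : ℕ) : Subgroup (Equiv.Perm ℤ) :=
  Subgroup.closure (signedSwap '' Set.Iio n)

theorem signedSwap_mem {i n : ℕ} (h : i < n) : signedSwap i ∈ signedPerm n :=
  Subgroup.subset_closure ⟨i, h, rfl⟩

theorem signedPerm_mono {m n : ℕ} (h : m ≤ n) : signedPerm m ≤ signedPerm n :=
  Subgroup.closure_mono (Set.image_mono fun _ hx => lt_of_lt_of_le hx h)

theorem signedPerm_neg {n : ℕ} {w : Equiv.Perm ℤ} (hw : w ∈ signedPerm n) (x : ℤ) :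
    w (-1 - x) = -1 - w x := by
  induction hw using Subgroup.closure_induction generalizing x with
  | mem w hw => obtain ⟨i, _, rfl⟩ := hw; exact signedSwap_neg i x
  | one => rfl
  | mul w w' _ _ hw hw' => simp only [Equiv.Perm.mul_apply, hw, hw']
  | inv w _ hw =>
    apply w.injective
    simp [hw]

theorem signedPerm_apply_self {m : ℕ} {w : Equiv.Perm ℤ} (hw : w ∈ signedPerm m) : w m = m := by
  induction hw using Subgroup.closure_induction with
  | mem w hw =>
    obtain ⟨i, hi, rfl⟩ := hw
    have : i < m := hi
    rw [signedSwap_apply]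
    split_ifs <;> omega
  | one => rfl
  | mul w w' _ _ hw hw' => rw [Equiv.Perm.mul_apply, hw', hw]
  | inv w _ hw => rw [Equiv.Perm.inv_eq_iff_eq, hw]

theorem zigzag_signedSwap_inv (m k : ℕ) : (zigzag signedSwap m k)⁻¹ m = (m : ℤ) - k := by
  induction k with
  | zero => simp [zigzag]
  | succ k ih =>
    rw [zigzag, mul_inv_rev, Equiv.Perm.mul_apply, ih, signedSwap_inv, signedSwap_apply]
    split_ifs <;> omega

theorem zigzag_signedSwap_mem {m k : ℕ} (hk : k < 2 * m + 2) :
    zigzag signedSwap m k ∈ signedPerm (m + 1) := by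
  induction k with
  | zero => exact one_mem _
  | succ k ih => exact mul_mem (ih (by omega)) (signedSwap_mem (by omega))

theorem prod_le_card_signedPerm (m : ℕ) (hf : Finite (signedPerm m)) :
    ∏ l ∈ Finset.range m, (2 * l + 2) ≤ Nat.card (signedPerm m) := by
  induction m with
  | zero => exact Nat.card_pos
  | succ m ih =>
    have hle := signedPerm_mono (Nat.le_add_right m 1)
    have : Finite (signedPerm m) := Finite.of_injective _ (Subgroup.inclusion_injective hle)
    rw [Finset.prod_range_succ]
    let g : signedPerm m × Fin (2 * m + 2) → signedPerm (m + 1) := fun p =>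
      ⟨p.1 * zigzag signedSwap m p.2, mul_mem (hle p.1.2) (zigzag_signedSwap_mem p.2.2)⟩
    have hg : Function.Injective g := by
      rintro ⟨⟨w, hw⟩, k⟩ ⟨⟨w', hw'⟩, k'⟩ h
      have h : w * zigzag signedSwap m k = w' * zigzag signedSwap m k' := congrArg Subtype.val h
      have hk : k = k' := by
        have h1 := congrArg (fun u : Equiv.Perm ℤ => u⁻¹ m) h
        simp only [mul_inv_rev, Equiv.Perm.mul_apply, signedPerm_apply_self (inv_mem hw),
          signedPerm_apply_self (inv_mem hw'), zigzag_signedSwap_inv] at h1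
        ext; omega
      subst hk
      simpa using h
    calc _ ≤ Nat.card (signedPerm m) * (2 * m + 2) := Nat.mul_le_mul_right _ (ih this)
      _ = Nat.card (signedPerm m × Fin (2 * m + 2)) := by simp [Nat.card_prod]
      _ ≤ _ := Nat.card_le_card_of_injective g hg

section Signed

variable {n : ℕ}

/-- The generators of `signedPerm n`, indexed by `Fin n`. -/
def signedGen (i : Fin n) : signedPerm n := ⟨signedSwap i, signedSwap_mem i.2⟩

/-- Left descents of signed permutations. -/
def signedDescent (i : Fin n) (w : signedPerm n) : Prop :=
  (w⁻¹ : signedPerm n).1 (i : ℕ) < (w⁻¹ : signedPerm n).1 ((i : ℕ) - 1)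

theorem closure_range_signedGen : Subgroup.closure (Set.range (signedGen (n := n))) = ⊤ := by
  have e : Set.range (signedGen (n := n)) =
      (Subtype.val : signedPerm n → Equiv.Perm ℤ) ⁻¹' (signedSwap '' Set.Iio n) := by
    ext ⟨w, hw⟩
    constructor
    · rintro ⟨i, hi⟩
      exact ⟨i, i.2, congrArg Subtype.val hi⟩
    · rintro ⟨i, hi, h⟩
      exact ⟨⟨i, hi⟩, Subtype.ext h⟩
  rw [e]
  exact Subgroup.closure_closure_coe_preimage

theorem signedDescent_exchange (i j : Fin n) (w : signedPerm n) :
    (signedDescent i (w * signedGen j) ↔ signedDescent i w) ∨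
      (signedGen i * w = w * signedGen j ∧ (signedDescent i w ↔ signedDescent j w⁻¹) ∧
        ((i : ℕ) = 0 ↔ (j : ℕ) = 0)) := by
  rw [or_iff_not_imp_left]
  intro h
  have e1 : ∀ x, ((w * signedGen j)⁻¹ : signedPerm n).1 x =
    signedSwap j ((w⁻¹ : signedPerm n).1 x) := fun x => rfl
  have hinv : ∀ x y, (w⁻¹ : signedPerm n).1 x = y → w.1 y = x := by
    rintro x _ rfl
    exact w.1.apply_symm_apply x
  have ne : (w⁻¹ : signedPerm n).1 (i : ℕ) ≠ (w⁻¹ : signedPerm n).1 ((i : ℕ) - 1) := by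
    intro h
    have := (w⁻¹ : signedPerm n).1.injective h
    omega
  simp only [signedDescent, e1, inv_inv] at h ⊢
  have hneg := signedPerm_neg w.2
  suffices hs : (w⁻¹ : signedPerm n).1 ((i : ℕ) - 1) < (w⁻¹ : signedPerm n).1 (i : ℕ) ∧
      (w.1 (j : ℕ) = (i : ℕ) ∧ w.1 ((j : ℕ) - 1) = (i : ℕ) - 1 ∨
        w.1 (j : ℕ) = -(i : ℕ) ∧ w.1 ((j : ℕ) - 1) = -1 - (i : ℕ)) ∨
      (w⁻¹ : signedPerm n).1 (i : ℕ) < (w⁻¹ : signedPerm n).1 ((i : ℕ) - 1) ∧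
      (w.1 (j : ℕ) = (i : ℕ) - 1 ∧ w.1 ((j : ℕ) - 1) = (i : ℕ) ∨
        w.1 (j : ℕ) = -1 - (i : ℕ) ∧ w.1 ((j : ℕ) - 1) = -(i : ℕ)) by
    have hc := signedSwap_conj (i := i) (j := j) hneg (by tauto)
    exact ⟨Subtype.ext hc.1, by omega, hc.2⟩
  have n1 := hneg (j : ℕ)
  have n2 := hneg ((j : ℕ) - 1)
  rw [show (-1 : ℤ) - ((j : ℕ) - 1) = -(j : ℕ) by ring] at n2
  rcases lt_or_gt_of_ne ne with hlt | hlt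
  · have h' : signedSwap j ((w⁻¹ : signedPerm n).1 ((i : ℕ) - 1)) ≤
        signedSwap j ((w⁻¹ : signedPerm n).1 (i : ℕ)) := by
      rwa [iff_true_intro hlt, iff_true, not_lt] at h
    rcases signedSwap_order hlt h' with ⟨hx, hy⟩ | ⟨hx, hy⟩ <;>
    · have hx' := hinv _ _ hx
      have hy' := hinv _ _ hy
      omega
  · have h' : signedSwap j ((w⁻¹ : signedPerm n).1 (i : ℕ)) ≤
        signedSwap j ((w⁻¹ : signedPerm n).1 ((i : ℕ) - 1)) := by
      have : ¬ (w⁻¹ : signedPerm n).1 (i : ℕ) < (w⁻¹ : signedPerm n).1 ((i : ℕ) - 1) := hlt.le.not_gt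
      simp only [this, iff_false, not_not] at h
      exact h.le
    rcases signedSwap_order hlt h' with ⟨hx, hy⟩ | ⟨hx, hy⟩ <;>
    · have hx' := hinv _ _ hx
      have hy' := hinv _ _ hy
      omega

/-- The signed permutations carry a descent datum for parameters that depend only on whether the
generator is the special one. -/
theorem descentDatum_signedPerm {K : Type*} [Field K] {a₀ a₁ b₀ b₁ : K} (h₀ : b₀ ≠ 0)
    (h₁ : b₁ ≠ 0) :
    DescentDatum K (signedGen (n := n)) signedDescent (fun i => if (i : ℕ) = 0 then a₀ else a₁)
      (fun i => if (i : ℕ) = 0 then b₀ else b₁) where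
  sq i := Subtype.ext (signedSwap_mul_self i)
  not_one i := by
    simp [signedDescent]
  simple_mul i w := by
    have e1 : ∀ x, ((signedGen i * w)⁻¹ : signedPerm n).1 x =
      (w⁻¹ : signedPerm n).1 (signedSwap i x) := fun x => rfl
    have e2 : signedSwap i (i : ℕ) = (i : ℕ) - 1 := by
      rw [signedSwap_apply]; split_ifs <;> omega
    have e3 : signedSwap i ((i : ℕ) - 1) = (i : ℕ) := by
      rw [signedSwap_apply]; split_ifs <;> omega
    have ne : (w⁻¹ : signedPerm n).1 (i : ℕ) ≠ (w⁻¹ : signedPerm n).1 ((i : ℕ) - 1) := by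
      intro h
      have := (w⁻¹ : signedPerm n).1.injective h
      omega
    simp only [signedDescent, e1, e2, e3]
    omega
  exchange i j w := by
    refine (signedDescent_exchange i j w).imp_right fun ⟨h1, h2, h3⟩ => ⟨h1, h2, ?_⟩
    simp only [h3, and_self]
  generate := closure_range_signedGen
  ne_zero i := by split_ifs <;> assumption

end Signed

section Representation

open Finsupp

variable {K : Type*} [Field K] {n : ℕ} {a b : Fin n → K}

theorem leftOp_comm (h : DescentDatum K (signedGen (n := n)) signedDescent a b) {i j : Fin n}
    (hij : (i : ℕ) + 1 < j) :
    leftOp signedGen signedDescent a b i * leftOp signedGen signedDescent a b j =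
      leftOp signedGen signedDescent a b j * leftOp signedGen signedDescent a b i := by
  have hc := h.commute
  refine h.ext_of_commute (fun k => (hc i k).mul_left (hc j k))
    (fun k => (hc j k).mul_left (hc i k)) ?_
  have h1 : ¬ signedDescent i (signedGen j) := by
    show ¬ signedSwap j (i : ℕ) < signedSwap j ((i : ℕ) - 1)
    simp only [signedSwap_apply]
    split_ifs <;> omega
  have h2 : ¬ signedDescent j (signedGen i) := by
    show ¬ signedSwap i (j : ℕ) < signedSwap i ((j : ℕ) - 1)
    simp only [signedSwap_apply]
    split_ifs <;> omega
  have e : signedGen i * signedGen j = signedGen j * signedGen i :=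
    Subtype.ext (signedSwap_comm hij)
  simp only [Module.End.mul_apply, h.leftOp_one, DescentDatum.leftOp_single_of_not h1,
    DescentDatum.leftOp_single_of_not h2, e]

theorem leftOp_braid (h : DescentDatum K (signedGen (n := n)) signedDescent a b) {i j : Fin n}
    (hi : 0 < (i : ℕ)) (hij : (j : ℕ) = i + 1) :
    leftOp signedGen signedDescent a b j * leftOp signedGen signedDescent a b i *
        leftOp signedGen signedDescent a b j =
      leftOp signedGen signedDescent a b i * leftOp signedGen signedDescent a b j *
        leftOp signedGen signedDescent a b i := by
  have hc := h.commute
  refine h.ext_of_commute (fun k => ((hc j k).mul_left (hc i k)).mul_left (hc j k))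
    (fun k => ((hc i k).mul_left (hc j k)).mul_left (hc i k)) ?_
  have v1 : signedSwap i (i : ℕ) = (i : ℕ) - 1 := by
    rw [signedSwap_apply]; split_ifs <;> omega
  have v2 : signedSwap i ((i : ℕ) - 1) = (i : ℕ) := by
    rw [signedSwap_apply]; split_ifs <;> omega
  have v3 : signedSwap i (j : ℕ) = (j : ℕ) := by
    rw [signedSwap_apply]; split_ifs <;> omega
  have v4 : signedSwap i ((j : ℕ) - 1) = (i : ℕ) - 1 := by
    rw [signedSwap_apply]; split_ifs <;> omega
  have v5 : signedSwap j (i : ℕ) = (j : ℕ) := by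
    rw [signedSwap_apply]; split_ifs <;> omega
  have v6 : signedSwap j ((i : ℕ) - 1) = (i : ℕ) - 1 := by
    rw [signedSwap_apply]; split_ifs <;> omega
  have v7 : signedSwap j (j : ℕ) = (i : ℕ) := by
    rw [signedSwap_apply]; split_ifs <;> omega
  have v8 : signedSwap j ((j : ℕ) - 1) = (j : ℕ) := by
    rw [signedSwap_apply]; split_ifs <;> omega
  have h1 : ¬ signedDescent i (signedGen j) := by
    show ¬ signedSwap j (i : ℕ) < signedSwap j ((i : ℕ) - 1)
    rw [v5, v6]; omega
  have h2 : ¬ signedDescent j (signedGen i) := by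
    show ¬ signedSwap i (j : ℕ) < signedSwap i ((j : ℕ) - 1)
    rw [v3, v4]; omega
  have h3 : ¬ signedDescent i (signedGen j * signedGen i) := by
    show ¬ signedSwap i (signedSwap j (i : ℕ)) < signedSwap i (signedSwap j ((i : ℕ) - 1))
    rw [v5, v6, v3, v2]; omega
  have h4 : ¬ signedDescent j (signedGen i * signedGen j) := by
    show ¬ signedSwap j (signedSwap i (j : ℕ)) < signedSwap j (signedSwap i ((j : ℕ) - 1))
    rw [v3, v4, v7, v6]; omega
  have e : signedGen j * (signedGen i * signedGen j) = signedGen i * (signedGen j * signedGen i) := by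
    have := signedSwap_braid hi
    rw [← hij, mul_assoc, mul_assoc] at this
    exact Subtype.ext this
  simp only [Module.End.mul_apply, h.leftOp_one, DescentDatum.leftOp_single_of_not h1,
    DescentDatum.leftOp_single_of_not h2, DescentDatum.leftOp_single_of_not h3,
    DescentDatum.leftOp_single_of_not h4, e]

theorem leftOp_braid_zero (h : DescentDatum K (signedGen (n := n)) signedDescent a b)
    {i j : Fin n} (hi : (i : ℕ) = 0) (hj : (j : ℕ) = 1) :
    leftOp signedGen signedDescent a b i * leftOp signedGen signedDescent a b j *
        leftOp signedGen signedDescent a b i * leftOp signedGen signedDescent a b j =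
      leftOp signedGen signedDescent a b j * leftOp signedGen signedDescent a b i *
        leftOp signedGen signedDescent a b j * leftOp signedGen signedDescent a b i := by
  have hc := h.commute
  refine h.ext_of_commute
    (fun k => (((hc i k).mul_left (hc j k)).mul_left (hc i k)).mul_left (hc j k))
    (fun k => (((hc j k).mul_left (hc i k)).mul_left (hc j k)).mul_left (hc i k)) ?_
  have h1 : ¬ signedDescent i (signedGen j) := by
    show ¬ signedSwap j (i : ℕ) < signedSwap j ((i : ℕ) - 1)
    rw [hi, hj]; decide
  have h2 : ¬ signedDescent j (signedGen i) := by
    show ¬ signedSwap i (j : ℕ) < signedSwap i ((j : ℕ) - 1)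
    rw [hi, hj]; decide
  have h3 : ¬ signedDescent i (signedGen j * signedGen i) := by
    show ¬ signedSwap i (signedSwap j (i : ℕ)) < signedSwap i (signedSwap j ((i : ℕ) - 1))
    rw [hi, hj]; decide
  have h4 : ¬ signedDescent j (signedGen i * signedGen j) := by
    show ¬ signedSwap j (signedSwap i (j : ℕ)) < signedSwap j (signedSwap i ((j : ℕ) - 1))
    rw [hi, hj]; decide
  have h5 : ¬ signedDescent i (signedGen j * (signedGen i * signedGen j)) := by
    show ¬ signedSwap j (signedSwap i (signedSwap j (i : ℕ))) <
      signedSwap j (signedSwap i (signedSwap j ((i : ℕ) - 1)))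
    rw [hi, hj]; decide
  have h6 : ¬ signedDescent j (signedGen i * (signedGen j * signedGen i)) := by
    show ¬ signedSwap i (signedSwap j (signedSwap i (j : ℕ))) <
      signedSwap i (signedSwap j (signedSwap i ((j : ℕ) - 1)))
    rw [hi, hj]; decide
  have e : signedGen i * (signedGen j * (signedGen i * signedGen j)) =
      signedGen j * (signedGen i * (signedGen j * signedGen i)) := by
    have := signedSwap_braid_zero
    rw [← hi, ← hj] at this
    simp only [mul_assoc] at this
    exact Subtype.ext this
  simp only [Module.End.mul_apply, h.leftOp_one, DescentDatum.leftOp_single_of_not h1,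
    DescentDatum.leftOp_single_of_not h2, DescentDatum.leftOp_single_of_not h3,
    DescentDatum.leftOp_single_of_not h4, DescentDatum.leftOp_single_of_not h5,
    DescentDatum.leftOp_single_of_not h6, e]

end Representation

section Quadratic

variable {K A : Type*} [Field K] [Ring A] [Algebra K A]

theorem sub_mul_sub_eq_zero_iff (α β : K) (x : A) :
    (x - algebraMap K A α) * (x - algebraMap K A β) = 0 ↔
      x * x = (α + β) • x + (-(α * β)) • 1 := by
  have e : (x - algebraMap K A α) * (x - algebraMap K A β) =
      x * x - ((α + β) • x + (-(α * β)) • 1) := by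
    simp only [Algebra.algebraMap_eq_smul_one, sub_mul, mul_sub, smul_mul_assoc, mul_smul_comm,
      one_mul, mul_one]
    module
  rw [e, sub_eq_zero]

theorem add_one_mul_sub_eq_zero_iff (q : K) (x : A) :
    (x + 1) * (x - algebraMap K A q) = 0 ↔ x * x = (q - 1) • x + q • 1 := by
  have e : (x + 1) * (x - algebraMap K A q) = x * x - ((q - 1) • x + q • 1) := by
    simp only [Algebra.algebraMap_eq_smul_one, add_mul, mul_sub, mul_smul_comm, one_mul, mul_one]
    module
  rw [e, sub_eq_zero]

end Quadratic

namespace HeckeB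

variable {K : Type} [Field K] {α β q : K} {n : ℕ}

/-- The generators of the Iwahori--Hecke algebra of type `Bₙ`. -/
noncomputable def gen (α β q : K) (i : Fin n) : HeckeB K α β q n :=
  RingQuot.mkAlgHom K (HeckeBRel K α β q n) (FreeAlgebra.ι K i)

theorem adjoin_range_gen : Algebra.adjoin K (Set.range (gen (n := n) α β q)) = ⊤ := by
  have e : Set.range (gen (n := n) α β q) =
      RingQuot.mkAlgHom K (HeckeBRel K α β q n) '' Set.range (FreeAlgebra.ι K) := by
    rw [← Set.range_comp]; rfl
  rw [e, ← AlgHom.map_adjoin, FreeAlgebra.adjoin_range_ι, Algebra.map_top,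
    AlgHom.range_eq_top]
  exact RingQuot.mkAlgHom_surjective K _

/-- The generators extended by zero to a sequence. -/
noncomputable def genSeq (α β q : K) (n i : ℕ) : HeckeB K α β q n :=
  if h : i < n then gen α β q ⟨i, h⟩ else 0

theorem genSeq_of_lt {i : ℕ} (h : i < n) : genSeq α β q n i = gen α β q ⟨i, h⟩ := dif_pos h

theorem adjoin_genSeq : Algebra.adjoin K (genSeq α β q n '' Set.Iio n) = ⊤ := by
  rw [← adjoin_range_gen (n := n)]
  congr 1
  ext x
  constructor
  · rintro ⟨i, hi, rfl⟩
    exact ⟨⟨i, hi⟩, (genSeq_of_lt hi).symm⟩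
  · rintro ⟨i, rfl⟩
    exact ⟨i, i.2, genSeq_of_lt i.2⟩

theorem isBraidedB_genSeq : IsBraidedB (genSeq α β q n) n where
  comm i j hij hj := by
    rw [genSeq_of_lt hj, genSeq_of_lt (by omega : i < n)]
    simpa [gen] using RingQuot.mkAlgHom_rel K
      (HeckeBRel.comm (α := α) (β := β) (q := q) ⟨i, by omega⟩ ⟨j, hj⟩ hij)
  braid i hi hj := by
    rw [genSeq_of_lt hj, genSeq_of_lt (by omega : i < n)]
    simpa [gen] using RingQuot.mkAlgHom_rel K
      (HeckeBRel.braid (α := α) (β := β) (q := q) ⟨i, by omega⟩ ⟨i + 1, hj⟩ hi rfl)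
  braid_zero h := by
    rw [genSeq_of_lt h, genSeq_of_lt (by omega : 0 < n)]
    simpa [gen] using RingQuot.mkAlgHom_rel K
      (HeckeBRel.braid_zero (α := α) (β := β) (q := q) ⟨0, by omega⟩ ⟨1, h⟩ rfl rfl)

theorem genSeq_mul_self {i : ℕ} (hi : i < n) :
    genSeq α β q n i * genSeq α β q n i =
      (if i = 0 then α + β else q - 1) • genSeq α β q n i + (if i = 0 then -(α * β) else q) • 1 := by
  rw [genSeq_of_lt hi]
  split_ifs with h0
  · have := RingQuot.mkAlgHom_rel K
      (HeckeBRel.quad_zero (α := α) (β := β) (q := q) ⟨i, hi⟩ h0)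
    simp only [map_mul, map_sub, map_zero, AlgHom.commutes] at this
    exact (sub_mul_sub_eq_zero_iff _ _ _).1 this
  · have := RingQuot.mkAlgHom_rel K
      (HeckeBRel.quad (α := α) (β := β) (q := q) ⟨i, hi⟩ (Nat.pos_of_ne_zero h0))
    simp only [map_mul, map_sub, map_add, map_one, map_zero, AlgHom.commutes] at this
    exact (add_one_mul_sub_eq_zero_iff _ _).1 this

theorem zigzagSpan_genSeq : zigzagSpan K (genSeq α β q n) n = ⊤ :=
  zigzagSpan_eq_top isBraidedB_genSeq (fun _ hi => genSeq_mul_self hi) adjoin_genSeq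

theorem finite : Module.Finite K (HeckeB K α β q n) := by
  have := finite_zigzagSpan (K := K) (genSeq α β q n) n
  rw [zigzagSpan_genSeq] at this
  exact Module.Finite.equiv Submodule.topEquiv

theorem finrank_le :
    Module.finrank K (HeckeB K α β q n) ≤ ∏ l ∈ Finset.range n, (2 * l + 2) := by
  have := finrank_zigzagSpan_le (K := K) (genSeq α β q n) n
  rwa [zigzagSpan_genSeq, finrank_top] at this

/-- The left regular representation on the free module over the signed permutations. -/
theorem exists_representation (hα : α ≠ 0) (hβ : β ≠ 0) (hq : q ≠ 0) :
    ∃ φ : HeckeB K α β q n →ₐ[K] Module.End K (signedPerm n →₀ K), ∀ i, φ (gen α β q i) =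
      leftOp signedGen signedDescent (fun i => if (i : ℕ) = 0 then α + β else q - 1)
        (fun i => if (i : ℕ) = 0 then -(α * β) else q) i := by
  have h := descentDatum_signedPerm (n := n) (a₀ := α + β) (a₁ := q - 1)
    (neg_ne_zero.2 (mul_ne_zero hα hβ)) hq
  set L := leftOp (signedGen (n := n)) signedDescent
    (fun i => if (i : ℕ) = 0 then α + β else q - 1)
    (fun i => if (i : ℕ) = 0 then -(α * β) else q)
  have hrel : ∀ ⦃x y⦄, HeckeBRel K α β q n x y →
      FreeAlgebra.lift K L x = FreeAlgebra.lift K L y := by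
    intro x y hxy
    cases hxy with
    | quad_zero i hi =>
      have := h.leftOp_mul_self i
      simp only [hi, if_true] at this
      simp only [map_mul, map_sub, map_zero, AlgHom.commutes, FreeAlgebra.lift_ι_apply]
      exact (sub_mul_sub_eq_zero_iff (A := Module.End K (signedPerm n →₀ K)) _ _ _).2 this
    | quad i hi =>
      have := h.leftOp_mul_self i
      simp only [hi.ne', if_false] at this
      simp only [map_mul, map_sub, map_add, map_one, map_zero, AlgHom.commutes,
        FreeAlgebra.lift_ι_apply]
      exact (add_one_mul_sub_eq_zero_iff (A := Module.End K (signedPerm n →₀ K)) _ _).2 this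
    | braid_zero i j hi hj =>
      simpa only [map_mul, FreeAlgebra.lift_ι_apply] using leftOp_braid_zero h hi hj
    | braid i j hi hij =>
      simpa only [map_mul, FreeAlgebra.lift_ι_apply] using leftOp_braid h hi hij
    | comm i j hij =>
      simpa only [map_mul, FreeAlgebra.lift_ι_apply] using leftOp_comm h hij
  refine ⟨RingQuot.liftAlgHom K ⟨FreeAlgebra.lift K L, hrel⟩, fun i => ?_⟩
  rw [gen, RingQuot.liftAlgHom_mkAlgHom_apply, FreeAlgebra.lift_ι_apply]

theorem exists_symmetrizing_trace (hα : α ≠ 0) (hβ : β ≠ 0) (hq : q ≠ 0) :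
    ∃ τ : HeckeB K α β q n →ₗ[K] K,
      (∀ x y, τ (x * y) = τ (y * x)) ∧ ∀ x, (∀ y, τ (x * y) = 0) → x = 0 := by
  have h := descentDatum_signedPerm (n := n) (a₀ := α + β) (a₁ := q - 1)
    (neg_ne_zero.2 (mul_ne_zero hα hβ)) hq
  obtain ⟨φ, hφ⟩ := exists_representation (n := n) hα hβ hq
  have hsurj := h.surjective adjoin_range_gen hφ
  have := finite (α := α) (β := β) (q := q) (n := n)
  have hfin : Module.Finite K (signedPerm n →₀ K) := Module.Finite.of_surjective _ hsurj
  have hW : Finite (signedPerm n) := Module.Finite.finite_basis (R := K) Finsupp.basisSingleOne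
  have hrank : Module.finrank K (signedPerm n →₀ K) = Nat.card (signedPerm n) :=
    Module.finrank_eq_nat_card_basis Finsupp.basisSingleOne
  have heq : Module.finrank K (HeckeB K α β q n) = Module.finrank K (signedPerm n →₀ K) :=
    le_antisymm (hrank ▸ finrank_le.trans (prod_le_card_signedPerm n hW))
      (LinearMap.finrank_le_finrank_of_surjective hsurj)
  exact h.exists_trace adjoin_range_gen hφ
    ((LinearMap.injective_iff_surjective_of_finrank_eq_finrank heq).2 hsurj)

end HeckeB

theorem heckeB_isSymmetricAlgebra
    (K : Type) [Field K] (q : K) (hq : q ≠ 0)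
    (f : ℕ) (hf : ((2 * f : ℕ) : ℕ∞) ≤ multOrder q) (n : ℕ) (hn : 1 ≤ n) :
    ∃ τ : HeckeB K 1 (q ^ f) q n →ₗ[K] K,
      (∀ a b : HeckeB K 1 (q ^ f) q n, τ (a * b) = τ (b * a)) ∧
      (∀ a : HeckeB K 1 (q ^ f) q n, (∀ b, τ (a * b) = 0) → a = 0) :=
  HeckeB.exists_symmetrizing_trace one_ne_zero (pow_ne_zero f hq) hq
end
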